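/- Let Λ be a right 4-Nakayama artin algebra and let M be a finitely generated indecomposable 4-factor serial right Λ-module which is both local and colocal. Then l(M) = 5 and the nonzero proper submodules of M are exactly the following six: rad(M), which is an indecomposable non-local 4-factor serial module of length 4; two submodules M1 and M2 of length 3, where M1 is uniserial and M2 is non-local 3-factor serial; two uniserial submodules N1 and N2 of length 2, where N1 is a submodule of both M1 and M2 and N2 is a submodule of M2; and soc(M), which is simple. -/

import Mathlib

/-! Basic definitions for (right) modules over a ring: radical, socle, length,
uniserial, local, indecomposable, `n`-factor serial, right `n`-Nakayama algebras,
Nakayama algebras and almost split sequences. -/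

universe u v w

section ModuleDefs

variable (A : Type v) [Ring A] (M : Type w) [AddCommGroup M] [Module A M]

/-- The composition length of a module, i.e. the Krull dimension of its submodule lattice. -/
noncomputable def moduleLength : WithBot ℕ∞ := Order.krullDim (Submodule A M)

/-- The radical of a module: the intersection of all its maximal submodules. -/
def moduleRad : Submodule A M := sInf {N : Submodule A M | IsCoatom N}

/-- The socle of a module: the sum of all its simple submodules. -/
def moduleSoc : Submodule A M := sSup {N : Submodule A M | IsAtom N}

variable {A M}

/-- The radical of a submodule `N`, viewed as a submodule of the ambient module. -/
def radOf (N : Submodule A M) : Submodule A M :=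
  Submodule.map N.subtype (moduleRad A ↥N)

/-- The socle of a submodule `N`, viewed as a submodule of the ambient module. -/
def socOf (N : Submodule A M) : Submodule A M :=
  Submodule.map N.subtype (moduleSoc A ↥N)

variable (A M)

/-- The iterated radical `rad^n(M)`, as a submodule of `M`. -/
def radPow : ℕ → Submodule A M
  | 0 => ⊤
  | n + 1 => radOf (radPow n)

/-- A module is uniserial if its submodules are totally ordered by inclusion. -/
def IsUniserialModule : Prop := ∀ N P : Submodule A M, N ≤ P ∨ P ≤ N

/-- A module is local if it has a unique maximal submodule. -/
def IsLocalModule : Prop := ∃! N : Submodule A M, IsCoatom N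

/-- A module is colocal if its socle is a simple submodule. -/
def IsColocalModule : Prop := IsAtom (moduleSoc A M)

/-- A module is indecomposable if it is nonzero and is not the direct sum of two
nonzero submodules. -/
def IsIndecModule : Prop :=
  Nontrivial M ∧ ∀ N P : Submodule A M, IsCompl N P → N = ⊥ ∨ P = ⊥

/-- The Loewy length of a module: the least `n` with `rad^n(M) = 0`. -/
noncomputable def loewyLength : ℕ := sInf {n : ℕ | radPow A M n = ⊥}

/-- A module `M` of length `l` is `n`-factor serial (`l ≥ n > 1`) if it is not uniserial,
`M/rad^{l-n}(M)` is uniserial and `M/rad^{l-n+1}(M)` is not uniserial. -/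
def IsNFactorSerial (n : ℕ) : Prop :=
  1 < n ∧ ¬ IsUniserialModule A M ∧
  ∃ l : ℕ, moduleLength A M = l ∧ n ≤ l ∧
    IsUniserialModule A (M ⧸ radPow A M (l - n)) ∧
    ¬ IsUniserialModule A (M ⧸ radPow A M (l - n + 1))

/-- `M` is `n`-factor serial, where `1`-factor serial means uniserial. -/
def IsFactorSerial (n : ℕ) : Prop :=
  (n = 1 ∧ IsUniserialModule A M) ∨ IsNFactorSerial A M n

end ModuleDefs

section AlgebraDefs

variable (Λ : Type u) [Ring Λ]

/-- A ring `Λ` is right `n`-Nakayama if every finitely generated indecomposable right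
`Λ`-module is `i`-factor serial for some `1 ≤ i ≤ n`, and there is at least one finitely
generated indecomposable `n`-factor serial right `Λ`-module.  Right `Λ`-modules are
realized as left `Λᵐᵒᵖ`-modules. -/
def IsRightNNakayama (n : ℕ) : Prop :=
  (∀ M : ModuleCat.{u} Λᵐᵒᵖ, Module.Finite Λᵐᵒᵖ M → IsIndecModule Λᵐᵒᵖ M →
      ∃ i, 1 ≤ i ∧ i ≤ n ∧ IsFactorSerial Λᵐᵒᵖ M i) ∧
  ∃ M : ModuleCat.{u} Λᵐᵒᵖ, Module.Finite Λᵐᵒᵖ M ∧ IsIndecModule Λᵐᵒᵖ M ∧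
    IsNFactorSerial Λᵐᵒᵖ M n

/-- A ring `Λ` is a Nakayama algebra if every finitely generated indecomposable projective
right `Λ`-module and every finitely generated indecomposable projective left `Λ`-module is
uniserial. -/
def IsNakayamaAlgebra : Prop :=
  (∀ M : ModuleCat.{u} Λᵐᵒᵖ, Module.Finite Λᵐᵒᵖ M → Module.Projective Λᵐᵒᵖ M →
      IsIndecModule Λᵐᵒᵖ M → IsUniserialModule Λᵐᵒᵖ M) ∧
  (∀ M : ModuleCat.{u} Λ, Module.Finite Λ M → Module.Projective Λ M →
      IsIndecModule Λ M → IsUniserialModule Λ M)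

end AlgebraDefs

section AlmostSplit

variable {A : Type v} [Ring A]

/-- A pair of maps `f : X → Y`, `g : Y → Z` is an almost split (Auslander-Reiten) sequence
if `0 → X → Y → Z → 0` is a non-split short exact sequence with `X` and `Z` indecomposable,
such that every homomorphism `V → Z` from a finitely generated module which is not a split
epimorphism factors through `g`. -/
def IsAlmostSplitSequence {X Y Z : Type w} [AddCommGroup X] [Module A X]
    [AddCommGroup Y] [Module A Y] [AddCommGroup Z] [Module A Z]
    (f : X →ₗ[A] Y) (g : Y →ₗ[A] Z) : Prop :=
  Function.Injective f ∧ Function.Surjective g ∧ LinearMap.range f = LinearMap.ker g ∧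
  (¬ ∃ s : Z →ₗ[A] Y, g ∘ₗ s = LinearMap.id) ∧
  IsIndecModule A X ∧ IsIndecModule A Z ∧
  ∀ V : ModuleCat.{w} A, Module.Finite A V →
    ∀ h : V →ₗ[A] Z, (¬ ∃ s : Z →ₗ[A] V, h ∘ₗ s = LinearMap.id) →
      ∃ k : V →ₗ[A] Y, g ∘ₗ k = h

end AlmostSplit

set_option linter.unusedSectionVars false

section Length

variable {A : Type v} [Ring A]

/-- The composition length of a module as a natural number. -/
noncomputable def len (A : Type v) [Ring A] (M : Type w) [AddCommGroup M] [Module A M] : ℕ :=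
  (Module.length A M).toNat

variable {M : Type w} [AddCommGroup M] [Module A M] [IsArtinian A M] [IsNoetherian A M]
variable {N : Type*} [AddCommGroup N] [Module A N] [IsArtinian A N] [IsNoetherian A N]

lemma coe_len (A : Type v) [Ring A] (M : Type w) [AddCommGroup M] [Module A M]
    [IsArtinian A M] [IsNoetherian A M] : (len A M : ℕ∞) = Module.length A M :=
  ENat.natCast_toNat Module.length_ne_top

lemma moduleLength_eq (A : Type v) [Ring A] (M : Type w) [AddCommGroup M] [Module A M]
    [IsArtinian A M] [IsNoetherian A M] : moduleLength A M = (len A M : ℕ) := by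
  rw [moduleLength, ← Module.coe_length, ← coe_len]; rfl

lemma len_congr {N : Type*} [AddCommGroup N] [Module A N] (e : M ≃ₗ[A] N) :
    len A M = len A N := by
  rw [len, len, e.length_eq]

lemma len_eq_zero_iff : len A M = 0 ↔ Subsingleton M := by
  rw [← Module.length_eq_zero_iff (R := A), ← coe_len]; simp

lemma len_bot : len A (⊥ : Submodule A M) = 0 := by
  rw [len_eq_zero_iff]; infer_instance

lemma len_top : len A (⊤ : Submodule A M) = len A M :=
  len_congr Submodule.topEquiv

lemma len_prod : len A (M × N) = len A M + len A N := by
  have h := Module.length_prod (R := A) (M := M) (N := N)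
  rw [← coe_len, ← coe_len, ← coe_len] at h
  exact_mod_cast h

lemma len_map_add (f : M →ₗ[A] N) (Z : Submodule A M) :
    len A (Z.map f) + len A (Z ⊓ LinearMap.ker f : Submodule A M) = len A Z := by
  have h := Module.length_eq_add_of_exact (R := A) (LinearMap.ker (f.domRestrict Z)).subtype
    (f.domRestrict Z).rangeRestrict (Submodule.subtype_injective _)
    (LinearMap.surjective_rangeRestrict _) (by
      rw [LinearMap.exact_iff, LinearMap.ker_rangeRestrict, Submodule.range_subtype])
  rw [← coe_len, ← coe_len, ← coe_len] at h
  have h1 : LinearMap.range (f.domRestrict Z) = Z.map f := LinearMap.range_domRestrict ..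
  have h2 : len A (LinearMap.ker (f.domRestrict Z)) =
      len A (Z ⊓ LinearMap.ker f : Submodule A M) := by
    have : (Z ⊓ LinearMap.ker f : Submodule A M) =
        (LinearMap.ker (f.domRestrict Z)).map Z.subtype := by
      ext x; simp [Submodule.mem_map, and_comm]
    rw [this]
    exact len_congr (Submodule.equivMapOfInjective _ (Submodule.subtype_injective _) _)
  rw [← h1, ← h2]
  have h' : len A Z = len A (LinearMap.ker (f.domRestrict Z)) +
    len A (LinearMap.range (f.domRestrict Z)) := by exact_mod_cast h
  omega

lemma len_range_add (f : M →ₗ[A] N) :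
    len A (LinearMap.range f) + len A (LinearMap.ker f) = len A M := by
  have := len_map_add f ⊤
  rwa [Submodule.map_top, top_inf_eq, len_top] at this

lemma len_lt {Y Z : Submodule A M} (h : Y < Z) : len A Y < len A Z := by
  have := Submodule.height_strictMono (R := A) (M := M) h
  rw [← Module.length_submodule, ← Module.length_submodule, ← coe_len, ← coe_len] at this
  exact_mod_cast this

lemma len_le {Y Z : Submodule A M} (h : Y ≤ Z) : len A Y ≤ len A Z := by
  rcases h.eq_or_lt with rfl | h
  · exact le_rfl
  · exact (len_lt h).le

lemma eq_of_len_le {Y Z : Submodule A M} (h : Y ≤ Z) (hl : len A Z ≤ len A Y) : Y = Z := by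
  by_contra hne
  have := len_lt (lt_of_le_of_ne h hne)
  omega

lemma len_le_len (Y : Submodule A M) : len A Y ≤ len A M := by
  rw [← len_top (A := A) (M := M)]; exact len_le le_top

lemma eq_top_of_len {Y : Submodule A M} (h : len A M ≤ len A Y) : Y = ⊤ :=
  eq_of_len_le le_top (by rwa [len_top])

lemma eq_bot_of_len {Y : Submodule A M} (h : len A Y = 0) : Y = ⊥ :=
  (eq_of_len_le bot_le (by omega)).symm

lemma len_pos {Y : Submodule A M} (h : Y ≠ ⊥) : 0 < len A Y := by
  by_contra h0
  exact h (eq_bot_of_len (by omega))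

lemma len_sup_add_inf (Y Z : Submodule A M) :
    len A (Y ⊔ Z : Submodule A M) + len A (Y ⊓ Z : Submodule A M) = len A Y + len A Z := by
  have h1 := len_map_add Z.mkQ (Y ⊔ Z)
  have h2 := len_map_add Z.mkQ Y
  have h3 : (Y ⊔ Z).map Z.mkQ = Y.map Z.mkQ := by
    rw [Submodule.map_sup, Submodule.mkQ_map_self, sup_bot_eq]
  rw [Submodule.ker_mkQ, h3, inf_eq_right.mpr (le_sup_right : Z ≤ Y ⊔ Z)] at h1
  rw [Submodule.ker_mkQ] at h2
  omega

lemma len_quotient_add (K : Submodule A M) : len A (M ⧸ K) + len A K = len A M := by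
  have := len_range_add K.mkQ
  rwa [Submodule.range_mkQ, Submodule.ker_mkQ, len_top] at this

lemma len_comap_mkQ (K : Submodule A M) (W : Submodule A (M ⧸ K)) :
    len A (W.comap K.mkQ) = len A W + len A K := by
  have := len_map_add K.mkQ (W.comap K.mkQ)
  rw [Submodule.map_comap_eq_of_surjective K.mkQ_surjective, Submodule.ker_mkQ,
    inf_eq_right.mpr (Submodule.le_comap_mkQ K W)] at this
  omega

lemma len_map_of_injective (f : M →ₗ[A] N) (hf : Function.Injective f) (Z : Submodule A M) :
    len A (Z.map f) = len A Z :=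
  (len_congr (Submodule.equivMapOfInjective f hf Z)).symm

lemma len_map_le (f : M →ₗ[A] N) (Z : Submodule A M) : len A (Z.map f) ≤ len A Z := by
  have := len_map_add f Z
  omega

lemma surjective_of_len (f : M →ₗ[A] N) (hf : Function.Injective f) (h : len A N ≤ len A M) :
    Function.Surjective f := by
  rw [← LinearMap.range_eq_top]
  apply eq_top_of_len
  have := len_range_add f
  rw [LinearMap.ker_eq_bot.mpr hf, len_bot] at this
  omega

lemma injective_of_len (f : M →ₗ[A] N) (hf : Function.Surjective f) (h : len A M ≤ len A N) :
    Function.Injective f := by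
  rw [← LinearMap.ker_eq_bot]
  apply eq_bot_of_len
  have := len_range_add f
  rw [LinearMap.range_eq_top.mpr hf, len_top] at this
  omega

lemma exists_coatom_ge {Y : Submodule A M} (h : Y ≠ ⊤) : ∃ Z, Y ≤ Z ∧ IsCoatom Z :=
  (eq_top_or_exists_le_coatom Y).resolve_left h |>.imp fun _ h => h.symm

lemma len_of_isCoatom {Y : Submodule A M} (h : IsCoatom Y) : len A Y + 1 = len A M := by
  have h1 := len_quotient_add Y
  have : IsSimpleModule A (M ⧸ Y) := isSimpleModule_iff_isCoatom.mpr h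
  have h2 : len A (M ⧸ Y) = 1 := by rw [len, Module.length_eq_one]; rfl
  omega

lemma len_eq_one_of_isSimple (A : Type v) [Ring A] (T : Type w) [AddCommGroup T] [Module A T]
    [IsSimpleModule A T] : len A T = 1 := by rw [len, Module.length_eq_one]; rfl

lemma isSimple_of_len (h : len A M = 1) : IsSimpleModule A M := by
  rw [← Module.length_eq_one_iff, ← coe_len, h]; rfl

lemma exists_len_le (Z : Submodule A M) {n : ℕ} (h : n ≤ len A Z) :
    ∃ Y ≤ Z, len A Y = n := by
  induction hk : len A Z - n generalizing Z with
  | zero => exact ⟨Z, le_rfl, by omega⟩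
  | succ k ih =>
    have hZ : (⊥ : Submodule A Z) ≠ ⊤ := by
      intro h0
      have := len_top (A := A) (M := Z)
      rw [← h0, len_bot] at this
      omega
    obtain ⟨C, -, hC⟩ := exists_coatom_ge hZ
    have h1 := len_of_isCoatom hC
    have h2 := len_map_of_injective Z.subtype Z.subtype_injective C
    obtain ⟨Y, hY, hl⟩ := ih (C.map Z.subtype) (by omega) (by omega)
    exact ⟨Y, hY.trans (Submodule.map_subtype_le Z C), hl⟩

end Length

section Uniform

variable {A : Type v} [Ring A]

/-- A module is uniform if any two nonzero submodules intersect nontrivially. -/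
def IsUniformModule (A : Type v) [Ring A] (M : Type w) [AddCommGroup M] [Module A M] : Prop :=
  ∀ Y Z : Submodule A M, Y ≠ ⊥ → Z ≠ ⊥ → Y ⊓ Z ≠ ⊥

/-- Indecomposable modules of finite length which are not local have length at most four. -/
def NonlocalBound (A : Type v) [Ring A] : Prop :=
  ∀ (P : Type w) [AddCommGroup P] [Module A P] [IsArtinian A P] [IsNoetherian A P],
    IsIndecModule A P → ∀ Y Z : Submodule A P, Y ≠ ⊤ → Z ≠ ⊤ → Y ⊔ Z = ⊤ → len A P ≤ 4

variable {M : Type w} [AddCommGroup M] [Module A M]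
variable {N : Type*} [AddCommGroup N] [Module A N]

lemma IsUniformModule.inf_ne_bot (hN : IsUniformModule A N) (f : M →ₗ[A] N)
    {K Y Z : Submodule A M} (hK : K ⊓ LinearMap.ker f = ⊥) (hY : Y ≤ K) (hZ : Z ≤ K)
    (hY0 : Y ≠ ⊥) (hZ0 : Z ≠ ⊥) : Y ⊓ Z ≠ ⊥ := by
  have key : ∀ x ∈ K, f x = 0 → x = 0 := fun x hx h => by
    have : x ∈ K ⊓ LinearMap.ker f := ⟨hx, h⟩
    simpa [hK] using this
  have hmap : ∀ W ≤ K, W ≠ ⊥ → W.map f ≠ ⊥ := by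
    intro W hW h0 h
    obtain ⟨x, hx, hx0⟩ := Submodule.exists_mem_ne_zero_of_ne_bot h0
    refine hx0 (key x (hW hx) ?_)
    have : f x ∈ W.map f := ⟨x, hx, rfl⟩
    simpa [h] using this
  obtain ⟨y, ⟨⟨a, ha, rfl⟩, ⟨b, hb, hab⟩⟩, hy0⟩ := Submodule.exists_mem_ne_zero_of_ne_bot
    (hN _ _ (hmap Y hY hY0) (hmap Z hZ hZ0))
  have : b = a := by
    rw [← sub_eq_zero]
    exact key _ (K.sub_mem (hZ hb) (hY ha)) (by rw [map_sub, hab, sub_self])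
  subst this
  rw [Submodule.ne_bot_iff]
  exact ⟨b, ⟨ha, hb⟩, fun h => hy0 (by rw [h, map_zero])⟩

lemma IsUniformModule.of_injective (hN : IsUniformModule A N) (f : M →ₗ[A] N)
    (hf : Function.Injective f) : IsUniformModule A M := fun _ _ h h' =>
  hN.inf_ne_bot f (K := ⊤) (by rw [LinearMap.ker_eq_bot.mpr hf, inf_bot_eq]) le_top le_top h h'

lemma IsUniformModule.submodule (hM : IsUniformModule A M) (Z : Submodule A M) :
    IsUniformModule A Z :=
  hM.of_injective Z.subtype Z.subtype_injective

lemma IsUniformModule.isIndec [Nontrivial M] (hM : IsUniformModule A M) : IsIndecModule A M := by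
  refine ⟨inferInstance, fun Y Z h => ?_⟩
  by_contra! h0
  exact hM Y Z h0.1 h0.2 h.inf_eq_bot

variable {P : Type*} [AddCommGroup P] [Module A P] [IsArtinian A P] [IsNoetherian A P]
variable {Y : Type*} [AddCommGroup Y] [Module A Y] [IsArtinian A Y] [IsNoetherian A Y]
variable {Z : Type*} [AddCommGroup Z] [Module A Z] [IsArtinian A Z] [IsNoetherian A Z]

lemma exists_section_of_len (p : P →ₗ[A] Y) {B : Submodule A P}
    (hB : B ⊓ LinearMap.ker p = ⊥) (h : len A Y ≤ len A B) :
    ∃ s : Y →ₗ[A] P, p ∘ₗ s = LinearMap.id := by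
  have hinj : Function.Injective (p.domRestrict B) := by
    rw [← LinearMap.ker_eq_bot, eq_bot_iff]
    intro x hx
    have : (x : P) ∈ B ⊓ LinearMap.ker p := ⟨x.2, hx⟩
    rw [hB] at this
    simpa using this
  let e := LinearEquiv.ofBijective _ ⟨hinj, surjective_of_len _ hinj h⟩
  refine ⟨B.subtype ∘ₗ e.symm.toLinearMap, LinearMap.ext fun y => ?_⟩
  exact e.apply_symm_apply y

lemma len_le_of_inf_ker (p : P →ₗ[A] Y) {B : Submodule A P}
    (hB : B ⊓ LinearMap.ker p = ⊥) : len A B ≤ len A Y := by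
  have h1 := len_map_add p B
  have h2 := len_le_len (B.map p)
  rw [hB, len_bot] at h1
  omega

lemma not_both_meet (p₁ : P →ₗ[A] Y) (p₂ : P →ₗ[A] Z)
    (hker : LinearMap.ker p₁ ⊓ LinearMap.ker p₂ = ⊥)
    (hY : IsUniformModule A Y) (hZ : IsUniformModule A Z) {B C : Submodule A P}
    (hBC : IsCompl B C) (hB : B ≠ ⊥)
    (hB1 : B ⊓ LinearMap.ker p₁ = ⊥) (hC1 : C ⊓ LinearMap.ker p₁ ≠ ⊥)
    (hC2 : C ⊓ LinearMap.ker p₂ ≠ ⊥) : False := by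
  have hmap : ∀ W : Submodule A P, W ≠ ⊥ → W ⊓ LinearMap.ker p₁ = ⊥ → W.map p₁ ≠ ⊥ := by
    intro W hW h1 h
    exact hW (by rwa [inf_eq_left.mpr (LinearMap.le_ker_iff_map.mpr h)] at h1)
  have hC21 : C ⊓ LinearMap.ker p₂ ⊓ LinearMap.ker p₁ = ⊥ := by
    rw [inf_assoc, inf_comm (LinearMap.ker p₂), hker, inf_bot_eq]
  obtain ⟨y, ⟨⟨b, hb, rfl⟩, ⟨a, ha, hab⟩⟩, hy0⟩ := Submodule.exists_mem_ne_zero_of_ne_bot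
    (hY _ _ (hmap B hB hB1) (hmap _ hC2 hC21))
  have hdisj := hBC.inf_eq_bot
  have hba : b - a ≠ 0 := by
    intro h
    have hb' : b ∈ B ⊓ C := ⟨hb, by rw [sub_eq_zero.mp h]; exact ha.1⟩
    rw [hdisj, Submodule.mem_bot] at hb'
    exact hy0 (by rw [hb', map_zero])
  have hba1 : b - a ∈ LinearMap.ker p₁ := by rw [LinearMap.mem_ker, map_sub, hab, sub_self]
  obtain ⟨z, ⟨hz1, hz2⟩, hz0⟩ := Submodule.exists_mem_ne_zero_of_ne_bot
    (hZ.inf_ne_bot p₂ hker (Y := Submodule.span A {b - a}) (Z := C ⊓ LinearMap.ker p₁)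
      (by simpa using hba1) inf_le_right (by simpa using hba) hC1)
  obtain ⟨c, rfl⟩ := Submodule.mem_span_singleton.mp hz1
  have hcb : c • b ∈ B ⊓ C := by
    refine ⟨B.smul_mem c hb, ?_⟩
    have : c • b = c • (b - a) + c • a := by rw [smul_sub, sub_add_cancel]
    rw [this]
    exact C.add_mem hz2.1 (C.smul_mem c ha.1)
  rw [hdisj, Submodule.mem_bot] at hcb
  have hca : c • a ∈ LinearMap.ker p₁ ⊓ LinearMap.ker p₂ := by
    refine ⟨?_, Submodule.smul_mem _ c ha.2⟩
    have := hz2.2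
    rw [smul_sub, hcb, zero_sub] at this
    exact neg_mem_iff.mp this
  rw [hker, Submodule.mem_bot] at hca
  exact hz0 (by rw [smul_sub, hca, hcb, sub_zero])

lemma exists_section_of_isCompl (p₁ : P →ₗ[A] Y) (p₂ : P →ₗ[A] Z)
    (hker : LinearMap.ker p₁ ⊓ LinearMap.ker p₂ = ⊥)
    (hY : IsUniformModule A Y) (hZ : IsUniformModule A Z)
    (hlen : len A P + 1 = len A Y + len A Z) {B C : Submodule A P}
    (hBC : IsCompl B C) (hB : B ≠ ⊥) (hC : C ≠ ⊥) :
    (∃ s : Y →ₗ[A] P, p₁ ∘ₗ s = LinearMap.id) ∨ ∃ s : Z →ₗ[A] P, p₂ ∘ₗ s = LinearMap.id := by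
  have hsum : len A B + len A C = len A P := by
    have := len_sup_add_inf B C
    rw [hBC.sup_eq_top, hBC.inf_eq_bot, len_bot, len_top] at this
    omega
  have main : ∀ {B C : Submodule A P}, len A B + len A C = len A P →
      B ⊓ LinearMap.ker p₁ = ⊥ → C ⊓ LinearMap.ker p₂ = ⊥ →
      (∃ s : Y →ₗ[A] P, p₁ ∘ₗ s = LinearMap.id) ∨
        ∃ s : Z →ₗ[A] P, p₂ ∘ₗ s = LinearMap.id := by
    intro B C hs h1 h2
    have := len_le_of_inf_ker p₁ h1
    have := len_le_of_inf_ker p₂ h2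
    by_cases h : len A Y ≤ len A B
    · exact Or.inl (exists_section_of_len p₁ h1 h)
    · exact Or.inr (exists_section_of_len p₂ h2 (by omega))
  have hdis : ∀ K : Submodule A P, B ⊓ K ⊓ (C ⊓ K) = ⊥ := fun K => by
    rw [eq_bot_iff, ← hBC.inf_eq_bot]
    exact inf_le_inf inf_le_left inf_le_left
  have hK1 : B ⊓ LinearMap.ker p₁ = ⊥ ∨ C ⊓ LinearMap.ker p₁ = ⊥ := by
    by_contra! h
    exact hZ.inf_ne_bot p₂ hker inf_le_right inf_le_right h.1 h.2 (hdis _)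
  have hK2 : B ⊓ LinearMap.ker p₂ = ⊥ ∨ C ⊓ LinearMap.ker p₂ = ⊥ := by
    by_contra! h
    rw [inf_comm] at hker
    exact hY.inf_ne_bot p₁ hker inf_le_right inf_le_right h.1 h.2 (hdis _)
  by_cases hB1 : B ⊓ LinearMap.ker p₁ = ⊥
  · by_cases hC2 : C ⊓ LinearMap.ker p₂ = ⊥
    · exact main hsum hB1 hC2
    · by_cases hC1 : C ⊓ LinearMap.ker p₁ = ⊥
      · exact main (by omega) hC1 (hK2.resolve_right hC2)
      · exact (not_both_meet p₁ p₂ hker hY hZ hBC hB hB1 hC1 hC2).elim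
  · have hC1 := hK1.resolve_left hB1
    by_cases hB2 : B ⊓ LinearMap.ker p₂ = ⊥
    · exact main (by omega) hC1 hB2
    · exact (not_both_meet p₁ p₂ hker hY hZ hBC.symm hC hC1 hB1 hB2).elim

end Uniform

section Pullback

variable {A : Type v} [Ring A]
variable {Y : Type w} [AddCommGroup Y] [Module A Y] [IsArtinian A Y] [IsNoetherian A Y]
variable {Z : Type w} [AddCommGroup Z] [Module A Z] [IsArtinian A Z] [IsNoetherian A Z]
variable {T : Type w} [AddCommGroup T] [Module A T] [IsSimpleModule A T]

lemma exists_smul_eq_of_isSimple {t : T} (ht : t ≠ 0) (t' : T) : ∃ a : A, a • t = t' := by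
  have := IsSimpleModule.span_singleton_eq_top A ht
  rw [← Submodule.mem_span_singleton, this]
  trivial

lemma surjective_of_ne_zero {W : Type*} [AddCommGroup W] [Module A W] (k : W →ₗ[A] T) {w : W}
    (hw : k w ≠ 0) : Function.Surjective k := fun t => by
  obtain ⟨a, ha⟩ := exists_smul_eq_of_isSimple (A := A) hw t
  exact ⟨a • w, by rw [map_smul, ha]⟩

/-- If the pullback of two maps onto a simple module is not local and of length at least five,
then one of the maps factors through the other. -/
lemma exists_factor_of_pullback (H : NonlocalBound.{v, w} A) (hY : IsUniformModule A Y)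
    (hZ : IsUniformModule A Z) (k : Y →ₗ[A] T) (k' : Z →ₗ[A] T)
    (hlen : 6 ≤ len A Y + len A Z) (D : Submodule A (Y × Z))
    (hD : ∀ z ∈ D, k z.1 = k' z.2) (hne : ∃ x y, k x = k' y ∧ (x, y) ∉ D)
    (hd : ∃ d ∈ D, k d.1 ≠ 0) :
    (∃ s : Y →ₗ[A] Z, ∀ y, k' (s y) = k y) ∨ ∃ s : Z →ₗ[A] Y, ∀ z, k (s z) = k' z := by
  obtain ⟨d, hdD, hd0⟩ := hd
  let f : Y × Z →ₗ[A] T := k ∘ₗ LinearMap.fst A Y Z - k' ∘ₗ LinearMap.snd A Y Z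
  let P := LinearMap.ker f
  have memP : ∀ z : Y × Z, z ∈ P ↔ k z.1 = k' z.2 := fun z => by
    simp [P, f, LinearMap.mem_ker, sub_eq_zero]
  have hlenP : len A P + 1 = len A Y + len A Z := by
    have hT : IsNoetherian A T := inferInstance
    have hT : IsArtinian A T := inferInstance
    have := len_range_add f
    have hf : LinearMap.range f = ⊤ := by
      rw [LinearMap.range_eq_top]
      exact surjective_of_ne_zero f (w := (d.1, 0)) (by simpa [f] using hd0)
    rw [hf, len_top, len_eq_one_of_isSimple, len_prod] at this
    change len A (LinearMap.ker f) + 1 = _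
    omega
  let p₁ : P →ₗ[A] Y := LinearMap.fst A Y Z ∘ₗ P.subtype
  let p₂ : P →ₗ[A] Z := LinearMap.snd A Y Z ∘ₗ P.subtype
  have hker : LinearMap.ker p₁ ⊓ LinearMap.ker p₂ = ⊥ := by
    rw [eq_bot_iff]
    rintro x ⟨h1, h2⟩
    exact Subtype.ext (Prod.ext h1 h2)
  have hPk : ∀ p : P, k (p₁ p) = k' (p₂ p) := fun p => (memP _).mp p.2
  have hnt : Nontrivial P := by
    by_contra h
    rw [not_nontrivial_iff_subsingleton, ← len_eq_zero_iff (A := A)] at h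
    omega
  have hnind : ¬ IsIndecModule A P := by
    intro hi
    have := H P hi (LinearMap.ker (k ∘ₗ p₁)) (D.comap P.subtype) ?_ ?_ ?_
    · omega
    · intro h
      have : (⟨d, (memP d).mpr (hD d hdD)⟩ : P) ∈ LinearMap.ker (k ∘ₗ p₁) := by
        rw [h]; trivial
      exact hd0 this
    · intro h
      obtain ⟨x, y, hxy, hn⟩ := hne
      have : (⟨(x, y), (memP _).mpr hxy⟩ : P) ∈ D.comap P.subtype := by rw [h]; trivial
      exact hn this
    · rw [eq_top_iff]
      intro p _
      obtain ⟨a, ha⟩ := exists_smul_eq_of_isSimple (A := A) hd0 (k (p₁ p))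
      have hdP : d ∈ P := (memP d).mpr (hD d hdD)
      rw [← sub_add_cancel p (a • (⟨d, hdP⟩ : P))]
      refine Submodule.add_mem_sup ?_ ?_
      · rw [LinearMap.mem_ker, map_sub, map_smul]
        change k (p₁ p) - a • k d.1 = 0
        rw [ha, sub_self]
      · exact D.smul_mem a hdD
  obtain ⟨B, C, hBC, hB, hC⟩ : ∃ B C : Submodule A P, IsCompl B C ∧ B ≠ ⊥ ∧ C ≠ ⊥ := by
    by_contra! h
    exact hnind ⟨hnt, fun B C hBC => or_iff_not_imp_left.mpr (h B C hBC)⟩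
  rcases exists_section_of_isCompl p₁ p₂ hker hY hZ hlenP hBC hB hC with ⟨s, hs⟩ | ⟨s, hs⟩
  · refine Or.inl ⟨p₂ ∘ₗ s, fun y => ?_⟩
    rw [LinearMap.comp_apply, ← hPk]
    exact congrArg k (LinearMap.congr_fun hs y)
  · refine Or.inr ⟨p₁ ∘ₗ s, fun y => ?_⟩
    rw [LinearMap.comp_apply, hPk]
    exact congrArg k' (LinearMap.congr_fun hs y)

/-- Uniform modules of length at least four are quasi-injective. -/
lemma IsUniformModule.exists_extend (H : NonlocalBound.{v, w} A) (hY : IsUniformModule A Y)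
    (hlen : 4 ≤ len A Y) (K : Submodule A Y) (f : K →ₗ[A] Y) :
    ∃ g : Y →ₗ[A] Y, ∀ x : K, g x = f x := by
  let G₀ : Submodule A (Y × Y) := LinearMap.range (f.prod K.subtype)
  let Q : Submodule A (Y × Y) := LinearMap.ker (LinearMap.snd A Y Y)
  have hQ : Q ⊓ LinearMap.ker (LinearMap.fst A Y Y) = ⊥ := by
    rw [eq_bot_iff]
    rintro x ⟨h1, h2⟩
    exact Prod.ext h2 h1
  obtain ⟨G, ⟨hG₀, hGQ⟩, hmax⟩ := WellFounded.has_min (α := Submodule A (Y × Y))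
    (wellFounded_gt) {G | G₀ ≤ G ∧ G ⊓ Q = ⊥} ⟨G₀, le_rfl, by
      rw [eq_bot_iff]
      rintro x ⟨⟨k, rfl⟩, h⟩
      have hk : k = 0 := Subtype.ext h
      subst hk
      simp⟩
  have hlG : len A (G.map (LinearMap.snd A Y Y)) = len A G := by
    have := len_map_add (LinearMap.snd A Y Y) G
    rw [hGQ, len_bot] at this
    omega
  have hlP := len_quotient_add G
  rw [len_prod] at hlP
  have hlG2 := len_le_len (G.map (LinearMap.snd A Y Y))
  have hlG1 := len_map_le (LinearMap.fst A Y Y) G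
  have hnt : Nontrivial ((Y × Y) ⧸ G) := by
    by_contra h
    rw [not_nontrivial_iff_subsingleton, ← len_eq_zero_iff (A := A)] at h
    omega
  have hun : IsUniformModule A ((Y × Y) ⧸ G) := by
    have hmeet : ∀ W : Submodule A ((Y × Y) ⧸ G), W ≠ ⊥ → W.comap G.mkQ ⊓ Q ≠ ⊥ := by
      intro W hW h
      have hle : G ≤ W.comap G.mkQ := Submodule.le_comap_mkQ G W
      refine hmax _ ⟨hG₀.trans hle, h⟩ (lt_of_le_of_ne hle fun h => hW ?_)
      rw [← Submodule.map_comap_eq_of_surjective G.mkQ_surjective W, ← h,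
        Submodule.mkQ_map_self]
    intro W W' hW hW'
    obtain ⟨z, ⟨hz1, hz2⟩, hz0⟩ := Submodule.exists_mem_ne_zero_of_ne_bot
      (hY.inf_ne_bot (LinearMap.fst A Y Y) hQ inf_le_right inf_le_right (hmeet W hW)
        (hmeet W' hW'))
    rw [Submodule.ne_bot_iff]
    refine ⟨G.mkQ z, ⟨hz1.1, hz2.1⟩, fun h => hz0 ?_⟩
    have : z ∈ G ⊓ Q := ⟨by simpa using h, hz1.2⟩
    simpa [hGQ] using this
  have htop : G.map (LinearMap.snd A Y Y) = ⊤ := by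
    by_contra hne
    have hlt : len A (G.map (LinearMap.snd A Y Y)) < len A Y := by
      rw [← len_top (M := Y)]; exact len_lt (lt_top_iff_ne_top.mpr hne)
    have hne1 : G.map (LinearMap.fst A Y Y) ≠ ⊤ := by
      intro h
      rw [h, len_top] at hlG1
      omega
    have hmk : ∀ W : Submodule A (Y × Y), G ≤ W → W.map G.mkQ = ⊤ → W = ⊤ := by
      intro W hW h
      have h2 := Submodule.comap_map_mkQ G W
      rw [h, Submodule.comap_top, sup_eq_right.mpr hW] at h2
      exact h2.symm
    have := H _ hun.isIndec
      (((G.map (LinearMap.snd A Y Y)).comap (LinearMap.snd A Y Y)).map G.mkQ)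
      (((G.map (LinearMap.fst A Y Y)).comap (LinearMap.fst A Y Y)).map G.mkQ) ?_ ?_ ?_
    · omega
    · intro h
      have h1 := hmk _ (Submodule.le_comap_map _ _) h
      apply hne
      rw [eq_top_iff]
      intro y _
      have : ((0, y) : Y × Y) ∈ (G.map (LinearMap.snd A Y Y)).comap (LinearMap.snd A Y Y) := by
        rw [h1]; trivial
      exact this
    · intro h
      have h1 := hmk _ (Submodule.le_comap_map _ _) h
      apply hne1
      rw [eq_top_iff]
      intro y _
      have : ((y, 0) : Y × Y) ∈ (G.map (LinearMap.fst A Y Y)).comap (LinearMap.fst A Y Y) := by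
        rw [h1]; trivial
      exact this
    · rw [← Submodule.map_sup, eq_top_iff]
      intro q _
      obtain ⟨⟨a, b⟩, rfl⟩ := G.mkQ_surjective q
      refine ⟨(a, b), ?_, rfl⟩
      have : ((a, b) : Y × Y) = (a, 0) + (0, b) := by simp
      rw [this]
      refine Submodule.add_mem_sup ?_ ?_
      · exact Submodule.zero_mem (G.map (LinearMap.snd A Y Y))
      · exact Submodule.zero_mem (G.map (LinearMap.fst A Y Y))
  have hinj : Function.Injective ((LinearMap.snd A Y Y).domRestrict G) := by
    rw [← LinearMap.ker_eq_bot, eq_bot_iff]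
    intro x hx
    have : (x : Y × Y) ∈ G ⊓ Q := ⟨x.2, hx⟩
    rw [hGQ] at this
    simpa using this
  have hsurj : Function.Surjective ((LinearMap.snd A Y Y).domRestrict G) := by
    rw [← LinearMap.range_eq_top, LinearMap.range_domRestrict, htop]
  let e := LinearEquiv.ofBijective _ ⟨hinj, hsurj⟩
  refine ⟨LinearMap.fst A Y Y ∘ₗ G.subtype ∘ₗ e.symm.toLinearMap, fun x => ?_⟩
  have hx : ((f x, (x : Y)) : Y × Y) ∈ G := hG₀ ⟨x, rfl⟩
  have : e.symm (x : Y) = ⟨(f x, (x : Y)), hx⟩ := by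
    rw [LinearEquiv.symm_apply_eq]; rfl
  simp [this]

end Pullback

section Vee

variable {A : Type v} [Ring A]

/-- A module is a vee if it is uniform of length three with two distinct submodules of
length two. -/
def IsVee (A : Type v) [Ring A] (K : Type w) [AddCommGroup K] [Module A K] : Prop :=
  IsUniformModule A K ∧ len A K = 3 ∧
    ∃ B B' : Submodule A K, len A B = 2 ∧ len A B' = 2 ∧ B ≠ B'

variable {X : Type w} [AddCommGroup X] [Module A X] [IsArtinian A X] [IsNoetherian A X]

lemma len_inf_of_len_eq {Y Z : Submodule A X} (h : len A Y = len A Z) (hne : Y ≠ Z) :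
    len A (Y ⊓ Z : Submodule A X) < len A Y := by
  by_contra hlt
  have h1 : Y ⊓ Z = Y := eq_of_len_le inf_le_left (by omega)
  exact hne (eq_of_len_le (inf_eq_left.mp h1) h.ge)

lemma len_sup_of_len_eq {Y Z : Submodule A X} (h : len A Y = len A Z) (hne : Y ≠ Z) :
    len A Y < len A (Y ⊔ Z : Submodule A X) := by
  have := len_inf_of_len_eq h hne
  have := len_sup_add_inf Y Z
  omega

lemma IsUniformModule.le_of_len (hX : IsUniformModule A X) {S Z : Submodule A X}
    (hS : len A S ≤ 1) (hZ : Z ≠ ⊥) : S ≤ Z := by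
  by_cases h : S = ⊥
  · exact h ▸ bot_le
  · have h1 := len_pos (hX S Z h hZ)
    exact inf_eq_left.mp (eq_of_len_le inf_le_left (by omega))

lemma IsUniformModule.len_inf_sup (hX : IsUniformModule A X) {Y Z : Submodule A X}
    (hY : len A Y = 2) (hZ : len A Z = 2) (hne : Y ≠ Z) :
    len A (Y ⊓ Z : Submodule A X) = 1 ∧ len A (Y ⊔ Z : Submodule A X) = 3 := by
  have h1 := len_inf_of_len_eq (hY.trans hZ.symm) hne
  have h2 := len_sup_add_inf Y Z
  have h3 := len_pos (hX Y Z (fun h => by rw [h, len_bot] at hY; omega)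
    (fun h => by rw [h, len_bot] at hZ; omega))
  omega

lemma len_comap_subtype {C Z : Submodule A X} (h : Z ≤ C) :
    len A (Z.comap C.subtype) = len A Z := by
  rw [← len_map_of_injective C.subtype C.subtype_injective, Submodule.map_comap_subtype,
    inf_eq_right.mpr h]

lemma comap_subtype_injOn {C Z Z' : Submodule A X} (h : Z ≤ C) (h' : Z' ≤ C)
    (he : Z.comap C.subtype = Z'.comap C.subtype) : Z = Z' := by
  have := congrArg (Submodule.map C.subtype) he
  rwa [Submodule.map_comap_subtype, Submodule.map_comap_subtype, inf_eq_right.mpr h,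
    inf_eq_right.mpr h'] at this

lemma IsUniformModule.isVee (hX : IsUniformModule A X) {C B B' : Submodule A X}
    (hC : len A C = 3) (hB : len A B = 2) (hB' : len A B' = 2) (hne : B ≠ B') (hBC : B ≤ C)
    (hBC' : B' ≤ C) : IsVee A C := by
  refine ⟨hX.submodule C, hC, B.comap C.subtype, B'.comap C.subtype, ?_, ?_, fun h => ?_⟩
  · rw [len_comap_subtype hBC, hB]
  · rw [len_comap_subtype hBC', hB']
  · exact hne (comap_subtype_injOn hBC hBC' h)

variable {K : Type w} [AddCommGroup K] [Module A K] [IsArtinian A K] [IsNoetherian A K]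
variable {K' : Type w} [AddCommGroup K'] [Module A K'] [IsArtinian A K'] [IsNoetherian A K']
variable {T : Type w} [AddCommGroup T] [Module A T] [IsSimpleModule A T]

lemma map_le_of_len_two (hK : IsUniformModule A K) (hX : IsUniformModule A X) (s : K →ₗ[A] X)
    (hs : LinearMap.ker s ≠ ⊥) {B : Submodule A K} (hB : len A B ≤ 2) {Z : Submodule A X}
    (hZ : Z ≠ ⊥) : B.map s ≤ Z := by
  by_cases h : B = ⊥
  · rw [h, Submodule.map_bot]; exact bot_le
  · refine hX.le_of_len ?_ hZ
    have := len_map_add s B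
    have := len_pos (hK B _ h hs)
    omega

lemma IsVee.range_le (hK : IsVee A K) (hX : IsUniformModule A X) (s : K →ₗ[A] X)
    (hs : LinearMap.ker s ≠ ⊥) {Z : Submodule A X} (hZ : Z ≠ ⊥) : LinearMap.range s ≤ Z := by
  obtain ⟨hK, h3, B, B', hB, hB', hne⟩ := hK
  have h1 := len_sup_of_len_eq (hB.trans hB'.symm) hne
  have h2 : B ⊔ B' = ⊤ := eq_top_of_len (by omega)
  rw [LinearMap.range_eq_map, ← h2, Submodule.map_sup]
  exact sup_le (map_le_of_len_two hK hX s hs hB.le hZ) (map_le_of_len_two hK hX s hs hB'.le hZ)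

lemma ker_ne_bot_of_len (k : K →ₗ[A] T) (h : 2 ≤ len A K) : LinearMap.ker k ≠ ⊥ := by
  intro h0
  have hT : IsNoetherian A T := inferInstance
  have hT : IsArtinian A T := inferInstance
  have := len_range_add k
  have h1 := len_le_len (LinearMap.range k)
  rw [h0, len_bot] at this
  have h2 := len_eq_one_of_isSimple A T
  omega

lemma exists_factor_of_submodule (H : NonlocalBound.{v, w} A) (hK : IsUniformModule A K)
    (hK' : IsUniformModule A K') (hlen : 6 ≤ len A K + len A K') (k : K →ₗ[A] T)
    (k' : K' →ₗ[A] T) (hk' : Function.Surjective k') {B : Submodule A K} (hB : B ≠ ⊤)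
    (hkB : ∃ b ∈ B, k b ≠ 0) :
    (∃ s : K →ₗ[A] K', ∀ y, k' (s y) = k y) ∨ ∃ s : K' →ₗ[A] K, ∀ z, k (s z) = k' z := by
  obtain ⟨b, hb, hb0⟩ := hkB
  obtain ⟨x, -, hx⟩ := SetLike.exists_of_lt (lt_top_iff_ne_top.mpr hB)
  obtain ⟨y, hy⟩ := hk' (k x)
  obtain ⟨c, hc⟩ := hk' (k b)
  let D : Submodule A (K × K') := LinearMap.ker
    (k ∘ₗ LinearMap.fst A K K' - k' ∘ₗ LinearMap.snd A K K') ⊓ B.comap (LinearMap.fst A K K')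
  refine exists_factor_of_pullback H hK hK' k k' hlen D (fun z hz => ?_)
    ⟨x, y, hy.symm, fun h => hx h.2⟩ ⟨(b, c), ⟨?_, hb⟩, hb0⟩
  · simpa [sub_eq_zero] using hz.1
  · simp [hc]

lemma IsVee.exists_equiv (H : NonlocalBound.{v, w} A) (hK : IsVee A K) (hK' : IsVee A K')
    (k : K →ₗ[A] T) (k' : K' →ₗ[A] T) (hk : k ≠ 0) (hk' : k' ≠ 0) :
    ∃ e : K ≃ₗ[A] K', ∀ x, k' (e x) = k x := by
  have key : ∀ {K K' : Type w} [AddCommGroup K] [Module A K] [IsArtinian A K]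
      [IsNoetherian A K] [AddCommGroup K'] [Module A K'] [IsArtinian A K'] [IsNoetherian A K'],
      IsVee A K → IsVee A K' → ∀ (k : K →ₗ[A] T) (k' : K' →ₗ[A] T), k ≠ 0 →
      ∀ s : K →ₗ[A] K', (∀ y, k' (s y) = k y) → Function.Bijective s := by
    intro K K' _ _ _ _ _ _ _ _ hK hK' k k' hk s hs
    have hinj : Function.Injective s := by
      rw [← LinearMap.ker_eq_bot]
      by_contra h
      have := hK.range_le hK'.1 s h (ker_ne_bot_of_len k' (by rw [hK'.2.1]; omega))
      exact hk (LinearMap.ext fun x => by rw [← hs]; exact this ⟨x, rfl⟩)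
    exact ⟨hinj, surjective_of_len s hinj (by rw [hK.2.1, hK'.2.1])⟩
  have hsur : Function.Surjective k' := by
    obtain ⟨x, hx⟩ := DFunLike.ne_iff.mp hk'
    exact surjective_of_ne_zero k' hx
  obtain ⟨B, hB2, hkB⟩ : ∃ B : Submodule A K, len A B = 2 ∧ ∃ b ∈ B, k b ≠ 0 := by
    obtain ⟨-, h3, B, B', hB, hB', hne⟩ := hK
    by_contra! h
    have h1 := len_sup_of_len_eq (hB.trans hB'.symm) hne
    have h2 : B ⊔ B' = ⊤ := eq_top_of_len (by omega)
    have h4 : B ⊔ B' ≤ LinearMap.ker k := sup_le (h B hB) (h B' hB')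
    rw [h2, top_le_iff] at h4
    exact hk (LinearMap.ker_eq_top.mp h4)
  have hBtop : B ≠ ⊤ := fun h => by
    rw [h, len_top, hK.2.1] at hB2
    omega
  rcases exists_factor_of_submodule H hK.1 hK'.1 (by rw [hK.2.1, hK'.2.1]) k k' hsur hBtop hkB
    with ⟨s, hs⟩ | ⟨s, hs⟩
  · exact ⟨LinearEquiv.ofBijective s (key hK hK' k k' hk s hs), hs⟩
  · refine ⟨(LinearEquiv.ofBijective s (key hK' hK k' k hk' s hs)).symm, fun x => ?_⟩
    rw [← hs]
    exact congrArg k ((LinearEquiv.ofBijective s _).apply_symm_apply x)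

lemma IsUniformModule.exists_extend_equiv (H : NonlocalBound.{v, w} A)
    (hX : IsUniformModule A X) (hlen : 4 ≤ len A X) {C C' : Submodule A X} (hC : C ≠ ⊥)
    (e : C ≃ₗ[A] C') :
    ∃ g : X →ₗ[A] X, Function.Injective g ∧ (∀ x : C, g x = e x) ∧ ∀ x, x ∈ C ↔ g x ∈ C' := by
  obtain ⟨g, hg⟩ := hX.exists_extend H hlen C (C'.subtype ∘ₗ e.toLinearMap)
  have hg' : ∀ x : C, g x = e x := hg
  have hinj : Function.Injective g := by
    rw [← LinearMap.ker_eq_bot]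
    by_contra h
    obtain ⟨x, ⟨hx, hx'⟩, hx0⟩ := Submodule.exists_mem_ne_zero_of_ne_bot (hX _ _ hC h)
    have h1 := hg' ⟨x, hx⟩
    rw [LinearMap.mem_ker.mp hx'] at h1
    have h2 : e ⟨x, hx⟩ = 0 := Subtype.ext h1.symm
    rw [LinearEquiv.map_eq_zero_iff] at h2
    exact hx0 (congrArg Subtype.val h2)
  refine ⟨g, hinj, hg', fun x => ⟨fun hx => ?_, fun hx => ?_⟩⟩
  · rw [hg' ⟨x, hx⟩]; exact (e ⟨x, hx⟩).2
  · have h1 := hg' (e.symm ⟨g x, hx⟩)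
    rw [e.apply_symm_apply] at h1
    rw [← hinj h1]
    exact (e.symm _).2

end Vee

section Triangle

variable {R : Type*} [CommRing R] [IsArtinianRing R]
variable {A : Type v} [Ring A] [Algebra R A] [Module.Finite R A]

lemma IsSimpleModule.noetherian_end (T : Type w) [AddCommGroup T] [Module A T] [Module R T]
    [IsScalarTower R A T] [IsSimpleModule A T] : IsNoetherian R (T →ₗ[A] T) := by
  have : Nontrivial T := IsSimpleModule.nontrivial A T
  obtain ⟨t, ht⟩ := exists_ne (0 : T)
  have : Module.Finite R T := Module.Finite.trans A T
  have : IsNoetherian R T := isNoetherian_of_isNoetherianRing_of_finite R T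
  let ev : (T →ₗ[A] T) →ₗ[R] T :=
    { toFun := fun f => f t
      map_add' := fun _ _ => rfl
      map_smul' := fun _ _ => rfl }
  refine isNoetherian_of_injective ev (LinearMap.ker_eq_bot.mp ?_)
  rw [eq_bot_iff]
  intro f hf
  refine LinearMap.ext fun x => ?_
  obtain ⟨a, rfl⟩ := exists_smul_eq_of_isSimple (A := A) ht x
  have : f t = 0 := hf
  simp [this]

variable {X : Type w} [AddCommGroup X] [Module A X] [IsArtinian A X] [IsNoetherian A X]

/-- In a uniform module of length four, the submodules of length three pairwise intersect in
the same submodule. -/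
lemma inf_le_of_len_three (R : Type*) [CommRing R] [IsArtinianRing R] [Algebra R A]
    [Module.Finite R A] (H : NonlocalBound.{v, w} A) (hX : IsUniformModule A X)
    (h4 : len A X = 4) {C₁ C₂ C₃ : Submodule A X} (h₁ : len A C₁ = 3) (h₂ : len A C₂ = 3)
    (h₃ : len A C₃ = 3) (hne : C₁ ≠ C₂) : C₁ ⊓ C₂ ≤ C₃ := by
  by_contra hA3
  have h13 : C₁ ≠ C₃ := fun h => hA3 (h ▸ inf_le_left)
  have h23 : C₂ ≠ C₃ := fun h => hA3 (h ▸ inf_le_right)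
  have len2 : ∀ {C C' : Submodule A X}, len A C = 3 → len A C' = 3 → C ≠ C' →
      len A (C ⊓ C' : Submodule A X) = 2 := by
    intro C C' h h' hn
    have := len_sup_of_len_eq (h.trans h'.symm) hn
    have := len_le_len (C ⊔ C')
    have := len_sup_add_inf C C'
    omega
  have l12 := len2 h₁ h₂ hne
  have l13 := len2 h₁ h₃ h13
  have l23 := len2 h₂ h₃ h23
  have hA1 : ¬ C₂ ⊓ C₃ ≤ C₁ := fun h => by
    have : C₂ ⊓ C₃ = C₁ ⊓ C₂ := eq_of_len_le (le_inf h inf_le_left) (by omega)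
    exact hA3 (this ▸ inf_le_right)
  have hA2 : ¬ C₁ ⊓ C₃ ≤ C₂ := fun h => by
    have : C₁ ⊓ C₃ = C₁ ⊓ C₂ := eq_of_len_le (le_inf inf_le_left h) (by omega)
    exact hA3 (this ▸ inf_le_right)
  have vee₁ : IsVee A C₁ := hX.isVee h₁ l12 l13 (fun h => hA3 (h ▸ inf_le_right))
    inf_le_left inf_le_left
  have vee₂ : IsVee A C₂ := hX.isVee h₂ l12 l23 (fun h => hA3 (h ▸ inf_le_right))
    inf_le_right inf_le_left
  have vee₃ : IsVee A C₃ := hX.isVee h₃ l13 l23 (fun h => hA2 (h ▸ inf_le_left))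
    inf_le_right inf_le_right
  have simp3 : ∀ {C : Submodule A X}, len A C = 3 → IsSimpleModule A (X ⧸ C) := fun {C} h =>
    isSimple_of_len (by have := len_quotient_add C; omega)
  have ne_zero : ∀ {C C' : Submodule A X}, len A C = len A C' → C ≠ C' →
      C'.mkQ ∘ₗ C.subtype ≠ 0 := by
    intro C C' hl hn h
    refine hn (eq_of_len_le (fun x hx => ?_) hl.ge)
    have := LinearMap.congr_fun h ⟨x, hx⟩
    simpa using this
  have s1 := simp3 h₁
  have s2 := simp3 h₂
  have s3 := simp3 h₃
  have ne_bot : ∀ {C : Submodule A X}, 0 < len A C → C ≠ ⊥ := fun h h' => by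
    rw [h', len_bot] at h; omega
  obtain ⟨e₁, -⟩ := vee₁.exists_equiv H vee₃ (C₂.mkQ ∘ₗ C₁.subtype) (C₂.mkQ ∘ₗ C₃.subtype)
    (ne_zero (h₁.trans h₂.symm) hne) (ne_zero (h₃.trans h₂.symm) h23.symm)
  obtain ⟨e₂, -⟩ := vee₂.exists_equiv H vee₃ (C₁.mkQ ∘ₗ C₂.subtype) (C₁.mkQ ∘ₗ C₃.subtype)
    (ne_zero (h₂.trans h₁.symm) hne.symm) (ne_zero (h₃.trans h₁.symm) h13.symm)
  obtain ⟨g₁, -, -, hg₁⟩ := hX.exists_extend_equiv H h4.ge (ne_bot (by omega)) e₁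
  obtain ⟨g₂, -, -, hg₂⟩ := hX.exists_extend_equiv H h4.ge (ne_bot (by omega)) e₂
  let k₁ : X →ₗ[A] X ⧸ C₃ := C₃.mkQ ∘ₗ g₁
  let k₂ : X →ₗ[A] X ⧸ C₃ := C₃.mkQ ∘ₗ g₂
  have hk₁ : ∀ x, k₁ x = 0 ↔ x ∈ C₁ := fun x => by simp [k₁, hg₁]
  have hk₂ : ∀ x, k₂ x = 0 ↔ x ∈ C₂ := fun x => by simp [k₂, hg₂]
  let E := (X ⧸ C₃) →ₗ[A] (X ⧸ C₃)
  let Rel : E → E → E → Prop := fun β γ ρ => ∃ g : X →ₗ[A] X,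
    (∀ x ∈ C₃, k₁ (g x) = β (k₁ x) + γ (k₂ x)) ∧ ∀ x, ρ (C₃.mkQ x) = C₃.mkQ (g x)
  have gen : C₃ ⊔ C₁ ⊓ C₂ = ⊤ := by
    apply eq_top_of_len
    have h5 : len A C₃ < len A (C₃ ⊔ C₁ ⊓ C₂ : Submodule A X) :=
      len_lt (lt_of_le_of_ne le_sup_left fun h => hA3 (le_sup_right.trans h.ge))
    omega
  have gen3 : C₁ ⊓ C₃ ⊔ C₂ ⊓ C₃ = C₃ := by
    have h5 := len_sup_of_len_eq (l13.trans l23.symm) (fun h => hA2 (h ▸ inf_le_left))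
    exact eq_of_len_le (sup_le inf_le_right inf_le_right) (by omega)
  have hinf3 : C₁ ⊓ C₃ ≠ ⊥ := ne_bot (by omega)
  have notinj : ∀ g : X →ₗ[A] X, LinearMap.ker g ≠ ⊥ → ∀ x, g x ∈ C₁ ⊓ C₃ := by
    intro g hg x
    have hsm : ∀ {B : Submodule A X}, len A B = 2 → B.map g ≤ C₁ ⊓ C₃ := fun hB =>
      map_le_of_len_two hX hX g hg hB.le hinf3
    have hr3 : C₃.map g ≤ C₁ ⊓ C₃ := by
      conv_lhs => rw [← gen3, Submodule.map_sup]
      exact sup_le (hsm l13) (hsm l23)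
    have hr : (⊤ : Submodule A X).map g ≤ C₁ ⊓ C₃ := by
      rw [← gen, Submodule.map_sup]
      exact sup_le hr3 (hsm l12)
    exact hr ⟨x, trivial, rfl⟩
  have isinj : ∀ g : X →ₗ[A] X, LinearMap.ker g = ⊥ → (∀ x ∈ C₃, g x ∈ C₃) →
      (∃ x ∈ C₃, k₁ (g x) ≠ 0) ∧ ∃ x, C₃.mkQ (g x) ≠ 0 := by
    intro g hg hg3
    have hinj := LinearMap.ker_eq_bot.mp hg
    have hsurj := surjective_of_len g hinj le_rfl
    have hmap : C₃.map g = C₃ := by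
      apply eq_of_len_le
      · rintro _ ⟨x, hx, rfl⟩; exact hg3 x hx
      · rw [len_map_of_injective g hinj]
    constructor
    · by_contra! h
      refine h13.symm (eq_of_len_le (fun x hx => ?_) (by omega))
      rw [← hmap] at hx
      obtain ⟨y, hy, rfl⟩ := hx
      exact (hk₁ _).mp (h y hy)
    · by_contra! h
      have : C₃ = ⊤ := by
        rw [eq_top_iff]
        intro x _
        obtain ⟨y, rfl⟩ := hsurj x
        simpa using h y
      rw [this, len_top] at h₃
      omega
  have relC : ∀ (ρ : E) (g : X →ₗ[A] X), (∀ x, ρ (C₃.mkQ x) = C₃.mkQ (g x)) →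
      ∀ x ∈ C₃, g x ∈ C₃ := by
    intro ρ g hρ x hx
    have h5 := hρ x
    have h6 : C₃.mkQ x = 0 := (Submodule.Quotient.mk_eq_zero C₃).mpr hx
    rw [h6, map_zero] at h5
    simpa using h5.symm
  have rel_zero : ∀ ρ, Rel 0 0 ρ → ρ = 0 := by
    rintro ρ ⟨g, hg1, hg2⟩
    by_cases hg : LinearMap.ker g = ⊥
    · obtain ⟨⟨x, hx, hx0⟩, -⟩ := isinj g hg (relC ρ g hg2)
      exact (hx0 ((hg1 x hx).trans (add_zero 0))).elim
    · refine LinearMap.ext fun q => ?_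
      obtain ⟨x, rfl⟩ := C₃.mkQ_surjective q
      rw [hg2]
      exact (Submodule.Quotient.mk_eq_zero C₃).mpr (notinj g hg x).2
  have zero_rel : ∀ β γ, Rel β γ 0 → β = 0 ∧ γ = 0 := by
    rintro β γ ⟨g, hg1, hg2⟩
    have hker : LinearMap.ker g ≠ ⊥ := by
      intro hg
      obtain ⟨-, x, hx⟩ := isinj g hg (relC 0 g hg2)
      exact hx (by rw [← hg2]; rfl)
    have h0 : ∀ x ∈ C₃, β (k₁ x) + γ (k₂ x) = 0 := fun x hx => by
      rw [← hg1 x hx, hk₁]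
      exact (notinj g hker x).1
    have zero_of : ∀ (δ : E) (t : X ⧸ C₃), t ≠ 0 → δ t = 0 → δ = 0 := by
      intro δ t ht hδ
      refine LinearMap.ext fun q => ?_
      obtain ⟨a, rfl⟩ := exists_smul_eq_of_isSimple (A := A) ht q
      simp [hδ]
    obtain ⟨x, ⟨hx2, hx3⟩, hx1⟩ := SetLike.not_le_iff_exists.mp hA1
    obtain ⟨y, ⟨hy1, hy3⟩, hy2⟩ := SetLike.not_le_iff_exists.mp hA2
    constructor
    · refine zero_of β (k₁ x) (fun h => hx1 ((hk₁ x).mp h)) ?_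
      have := h0 x hx3
      rwa [(hk₂ x).mpr hx2, map_zero, add_zero] at this
    · refine zero_of γ (k₂ y) (fun h => hy2 ((hk₂ y).mp h)) ?_
      have := h0 y hy3
      rwa [(hk₁ y).mpr hy1, map_zero, zero_add] at this
  have ex_rel : ∀ p : E × E, ∃ ρ, Rel p.1 p.2 ρ := by
    rintro ⟨β, γ⟩
    suffices h : ∃ g : X →ₗ[A] X, (∀ x ∈ C₃, g x ∈ C₃) ∧
        ∀ x ∈ C₃, k₁ (g x) = β (k₁ x) + γ (k₂ x) by
      obtain ⟨g, hg3, hg⟩ := h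
      exact ⟨C₃.mapQ C₃ g hg3, g, hg, fun x => rfl⟩
    let h : C₃ →ₗ[A] X ⧸ C₃ := (β ∘ₗ k₁ + γ ∘ₗ k₂) ∘ₗ C₃.subtype
    by_cases hh : h = 0
    · refine ⟨0, fun x _ => by simp, fun x hx => ?_⟩
      have := LinearMap.congr_fun hh ⟨x, hx⟩
      simpa [h] using this.symm
    · have hk10 : k₁ ∘ₗ C₃.subtype ≠ 0 := by
        intro h5
        refine h13.symm (eq_of_len_le (fun x hx => ?_) (by omega))
        exact (hk₁ x).mp (LinearMap.congr_fun h5 ⟨x, hx⟩)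
      obtain ⟨e, he⟩ := vee₃.exists_equiv H vee₃ h (k₁ ∘ₗ C₃.subtype) hh hk10
      obtain ⟨g, -, hg, hg3⟩ := hX.exists_extend_equiv H h4.ge (ne_bot (by omega)) e
      refine ⟨g, fun x hx => (hg3 x).mp hx, fun x hx => ?_⟩
      have h5 := he ⟨x, hx⟩
      rw [LinearMap.comp_apply] at h5
      rw [hg ⟨x, hx⟩]
      exact h5
  let _ : Module R X := Module.compHom X (algebraMap R A)
  have : IsScalarTower R A X := ⟨fun r a x => by
    rw [Algebra.smul_def, mul_smul]; rfl⟩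
  have rel_sub : ∀ {β γ ρ β' γ' ρ'}, Rel β γ ρ → Rel β' γ' ρ' →
      Rel (β - β') (γ - γ') (ρ - ρ') := by
    rintro β γ ρ β' γ' ρ' ⟨g, hg1, hg2⟩ ⟨g', hg1', hg2'⟩
    refine ⟨g - g', fun x hx => ?_, fun x => ?_⟩
    · change k₁ (g x - g' x) = (β (k₁ x) - β' (k₁ x)) + (γ (k₂ x) - γ' (k₂ x))
      rw [map_sub, hg1 x hx, hg1' x hx]
      abel
    · rw [LinearMap.sub_apply, hg2, hg2', LinearMap.sub_apply, map_sub]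
  have rel_add : ∀ {β γ ρ β' γ' ρ'}, Rel β γ ρ → Rel β' γ' ρ' →
      Rel (β + β') (γ + γ') (ρ + ρ') := by
    rintro β γ ρ β' γ' ρ' ⟨g, hg1, hg2⟩ ⟨g', hg1', hg2'⟩
    refine ⟨g + g', fun x hx => ?_, fun x => ?_⟩
    · change k₁ (g x + g' x) = (β (k₁ x) + β' (k₁ x)) + (γ (k₂ x) + γ' (k₂ x))
      rw [map_add, hg1 x hx, hg1' x hx]
      abel
    · rw [LinearMap.add_apply, hg2, hg2', LinearMap.add_apply, map_add]
  have rel_smul : ∀ (r : R) {β γ ρ}, Rel β γ ρ → Rel (r • β) (r • γ) (r • ρ) := by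
    rintro r β γ ρ ⟨g, hg1, hg2⟩
    refine ⟨r • g, fun x hx => ?_, fun x => ?_⟩
    · rw [LinearMap.smul_apply, LinearMap.smul_apply, LinearMap.smul_apply,
        LinearMap.map_smul_of_tower, hg1 x hx, smul_add]
    · rw [LinearMap.smul_apply, LinearMap.smul_apply, hg2, LinearMap.map_smul_of_tower]
  choose F hF using ex_rel
  have uniq : ∀ {β γ ρ ρ'}, Rel β γ ρ → Rel β γ ρ' → ρ = ρ' := fun h h' => by
    have := rel_sub h h'
    rw [sub_self, sub_self] at this
    exact sub_eq_zero.mp (rel_zero _ this)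
  let Φ : (E × E) →ₗ[R] E :=
    { toFun := F
      map_add' := fun p q => uniq (hF _) (rel_add (hF p) (hF q))
      map_smul' := fun r p => uniq (hF _) (rel_smul r (hF p)) }
  have hΦ : Function.Injective Φ := by
    rw [← LinearMap.ker_eq_bot, eq_bot_iff]
    rintro p hp
    have hp' : F p = 0 := hp
    have := hF p
    rw [hp'] at this
    obtain ⟨hβ, hγ⟩ := zero_rel _ _ this
    exact Prod.ext hβ hγ
  have : IsNoetherian R E := IsSimpleModule.noetherian_end (X ⧸ C₃)
  have hsub : Subsingleton E := IsNoetherian.subsingleton_of_prod_injective Φ hΦ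
  have hnt : Nontrivial (X ⧸ C₃) := IsSimpleModule.nontrivial A _
  obtain ⟨t, ht⟩ := exists_ne (0 : X ⧸ C₃)
  exact ht (LinearMap.congr_fun (Subsingleton.elim (LinearMap.id : E) 0) t)

end Triangle

section LengthFive

variable {A : Type v} [Ring A]
variable {X : Type w} [AddCommGroup X] [Module A X] [IsArtinian A X] [IsNoetherian A X]
variable {W : Type w} [AddCommGroup W] [Module A W] [IsArtinian A W] [IsNoetherian A W]

lemma ne_bot_of_len {Z : Submodule A X} (h : 0 < len A Z) : Z ≠ ⊥ := fun h' => by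
  rw [h', len_bot] at h; omega

lemma IsUniformModule.len_sup_le (H : NonlocalBound.{v, w} A) (hX : IsUniformModule A X)
    {Y Z : Submodule A X} (hYZ : ¬ Y ≤ Z) (hZY : ¬ Z ≤ Y) :
    len A (Y ⊔ Z : Submodule A X) ≤ 4 := by
  have hnt : Nontrivial (Y ⊔ Z : Submodule A X) := by
    rw [Submodule.nontrivial_iff_ne_bot]
    intro h
    rw [sup_eq_bot_iff] at h
    exact hYZ (h.1 ▸ bot_le)
  refine H _ (hX.submodule (Y ⊔ Z)).isIndec (Y.comap (Y ⊔ Z).subtype)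
    (Z.comap (Y ⊔ Z).subtype) ?_ ?_ ?_
  · rw [Ne, Submodule.comap_subtype_eq_top, sup_le_iff]
    exact fun h => hZY h.2
  · rw [Ne, Submodule.comap_subtype_eq_top, sup_le_iff]
    exact fun h => hYZ h.1
  · rw [eq_top_iff]
    rintro ⟨x, hx⟩ -
    obtain ⟨y, hy, z, hz, rfl⟩ := Submodule.mem_sup.mp hx
    exact Submodule.mem_sup.mpr ⟨⟨y, le_sup_left (a := Y) hy⟩, hy,
      ⟨z, le_sup_right (b := Z) hz⟩, hz, rfl⟩

lemma exists_lift_quotient_ker {K V : Type w} [AddCommGroup K] [Module A K] [AddCommGroup V]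
    [Module A V] (φ : W →ₗ[A] V) (q : K →ₗ[A] V) {U : Submodule A W} (hU : LinearMap.ker φ = U)
    (h : LinearMap.range q ≤ LinearMap.range φ) :
    ∃ f : K →ₗ[A] W ⧸ U, ∀ x, f x = 0 ↔ q x = 0 := by
  subst hU
  refine ⟨φ.quotKerEquivRange.symm.toLinearMap ∘ₗ
    q.codRestrict (LinearMap.range φ) (fun x => h ⟨x, rfl⟩), fun x => ?_⟩
  simp [← Subtype.val_inj]

/-- Quotients of a vee by two distinct submodules of length two, one of which is invariant
under automorphisms of the ambient module, are not isomorphic. -/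
lemma false_of_quotients (H : NonlocalBound.{v, w} A) (hX : IsUniformModule A X)
    (hlen : 4 ≤ len A X) {K N₁ N₂ : Submodule A X} (hK : len A K = 3) (hN₁ : len A N₁ = 2)
    (hN₂ : len A N₂ = 2) (hne : N₁ ≠ N₂) (hN₁K : N₁ ≤ K) (hN₂K : N₂ ≤ K)
    (hinv : ∀ g : X →ₗ[A] X, Function.Injective g → ∀ x, x ∈ N₁ ↔ g x ∈ N₁)
    (φ₁ : W →ₗ[A] X ⧸ N₁) (φ₂ : W →ₗ[A] X ⧸ N₂) (hker : LinearMap.ker φ₁ = LinearMap.ker φ₂)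
    (h₁ : LinearMap.range φ₁ = K.map N₁.mkQ) (h₂ : LinearMap.range φ₂ = K.map N₂.mkQ) :
    False := by
  have hvee : IsVee A K := hX.isVee hK hN₁ hN₂ hne hN₁K hN₂K
  obtain ⟨f₁, hf₁⟩ := exists_lift_quotient_ker φ₁ (N₁.mkQ ∘ₗ K.subtype) rfl
    (by rw [LinearMap.range_comp, Submodule.range_subtype, h₁])
  obtain ⟨f₂, hf₂⟩ := exists_lift_quotient_ker φ₂ (N₂.mkQ ∘ₗ K.subtype) hker.symm
    (by rw [LinearMap.range_comp, Submodule.range_subtype, h₂])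
  have hf₁' : ∀ x : K, f₁ x = 0 ↔ (x : X) ∈ N₁ := fun x => by rw [hf₁]; simp
  have hf₂' : ∀ x : K, f₂ x = 0 ↔ (x : X) ∈ N₂ := fun x => by rw [hf₂]; simp
  have hsimple : IsSimpleModule A (W ⧸ LinearMap.ker φ₁) := by
    apply isSimple_of_len
    have e1 := len_quotient_add (LinearMap.ker φ₁)
    have e2 := len_range_add φ₁
    have e3 := len_map_add N₁.mkQ K
    rw [Submodule.ker_mkQ, inf_eq_right.mpr hN₁K] at e3
    rw [h₁] at e2
    omega
  have hnz : ∀ {N : Submodule A X} (f : K →ₗ[A] W ⧸ LinearMap.ker φ₁),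
      (∀ x : K, f x = 0 ↔ (x : X) ∈ N) → len A N = 2 → f ≠ 0 := by
    intro N f hf hN h
    have : K ≤ N := fun x hx => (hf ⟨x, hx⟩).mp (by rw [h]; rfl)
    have := len_le this
    omega
  obtain ⟨e, he⟩ := hvee.exists_equiv H hvee f₂ f₁ (hnz f₂ hf₂' hN₂) (hnz f₁ hf₁' hN₁)
  obtain ⟨g, hginj, hg, -⟩ := hX.exists_extend_equiv H hlen (ne_bot_of_len (by omega)) e
  refine hne (eq_of_len_le (fun x hx => ?_) (by omega))
  have hxK := hN₁K hx
  rw [← hf₂' ⟨x, hxK⟩, ← he, hf₁', ← hg]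
  exact (hinv g hginj x).mp hx

lemma mem_iff_of_len_three {N₁ C₁ C₂ : Submodule A X} (hN₁ : len A N₁ = 2)
    (hC₁ : len A C₁ = 3) (hC₂ : len A C₂ = 3) (hne : C₁ ≠ C₂)
    (hN : ∀ C : Submodule A X, len A C = 3 → N₁ ≤ C) (g : X →ₗ[A] X)
    (hg : Function.Injective g) (x : X) : x ∈ N₁ ↔ g x ∈ N₁ := by
  have hinf : C₁ ⊓ C₂ = N₁ := by
    have := len_inf_of_len_eq (hC₁.trans hC₂.symm) hne
    exact (eq_of_len_le (le_inf (hN _ hC₁) (hN _ hC₂)) (by omega)).symm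
  have hsurj := surjective_of_len g hg le_rfl
  have hcomap : ∀ {C : Submodule A X}, len A C = 3 → N₁.map g ≤ C := by
    intro C hC
    rw [Submodule.map_le_iff_le_comap]
    apply hN
    rw [← len_map_of_injective g hg, Submodule.map_comap_eq_of_surjective hsurj, hC]
  have hmap : N₁.map g = N₁ := by
    refine eq_of_len_le ?_ (by rw [len_map_of_injective g hg])
    conv_rhs => rw [← hinf]
    exact le_inf (hcomap hC₁) (hcomap hC₂)
  refine ⟨fun h => hmap ▸ Submodule.mem_map_of_mem h, fun h => ?_⟩
  rw [← hmap] at h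
  obtain ⟨y, hy, hyx⟩ := h
  rwa [← hg hyx]

lemma le_of_len_quotient {M₁ N₁ S : Submodule A X} (hS : len A S = 1) (hSM : S ≤ M₁)
    (hU : ∀ B ≤ M₁, len A B = 2 → B = N₁) {V : Submodule A (M₁ ⧸ S.comap M₁.subtype)}
    (hV : V ≠ ⊥) : N₁.comap M₁.subtype ≤ V.comap (S.comap M₁.subtype).mkQ := by
  have h1 := len_comap_mkQ _ V
  have h2 := len_pos hV
  rw [len_comap_subtype hSM] at h1
  obtain ⟨B, hB, hB2⟩ := exists_len_le (V.comap (S.comap M₁.subtype).mkQ) (n := 2) (by omega)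
  have h3 : B.map M₁.subtype = N₁ := hU _ (Submodule.map_subtype_le _ _)
    (by rw [len_map_of_injective _ M₁.subtype_injective, hB2])
  intro n hn
  rw [← h3] at hn
  obtain ⟨b, hb, hbn⟩ := hn
  rw [← M₁.subtype_injective hbn]
  exact hB hb

lemma uniform_quotient {M₁ N₁ S : Submodule A X} (hS : len A S = 1) (hSM : S ≤ M₁)
    (hU : ∀ B ≤ M₁, len A B = 2 → B = N₁) (hN₁ : len A N₁ = 2) (hNM : N₁ ≤ M₁) :
    IsUniformModule A (M₁ ⧸ S.comap M₁.subtype) := by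
  intro V V' hV hV'
  obtain ⟨n, hn, hnS⟩ := SetLike.not_le_iff_exists.mp
    (fun h : N₁ ≤ S => by have := len_le h; omega)
  rw [Submodule.ne_bot_iff]
  refine ⟨(S.comap M₁.subtype).mkQ ⟨n, hNM hn⟩, ⟨?_, ?_⟩, ?_⟩
  · exact le_of_len_quotient hS hSM hU hV (x := ⟨n, hNM hn⟩) hn
  · exact le_of_len_quotient hS hSM hU hV' (x := ⟨n, hNM hn⟩) hn
  · simpa using hnS

lemma exists_of_two_uniserial (H : NonlocalBound.{v, w} A) (hX : IsUniformModule A X)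
    {L M₁ M₁' N₁ S : Submodule A X} (hL : len A L = 4) (hM₁ : len A M₁ = 3)
    (hM₁' : len A M₁' = 3) (hne : M₁ ≠ M₁') (hN₁ : len A N₁ = 2) (hS : len A S = 1)
    (hML : M₁ ≤ L) (hML' : M₁' ≤ L) (hNM : N₁ ≤ M₁)
    (hU : ∀ B ≤ M₁, len A B = 2 → B = N₁) (hU' : ∀ B ≤ M₁', len A B = 2 → B = N₁) :
    ∃ ψ : M₁ →ₗ[A] X, ∀ x, ψ x ∈ L ∧ ((x : X) ∈ S → ψ x = 0) ∧ ψ x - x ∈ M₁' := by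
  have hSM : S ≤ M₁ := hX.le_of_len hS.le (ne_bot_of_len (by omega))
  have hSM' : S ≤ M₁' := hX.le_of_len hS.le (ne_bot_of_len (by omega))
  let ML := M₁.comap L.subtype
  let ML' := M₁'.comap L.subtype
  let S' := S.comap M₁.subtype
  have hlML : len A ML = 3 := by rw [len_comap_subtype hML, hM₁]
  have hlML' : len A ML' = 3 := by rw [len_comap_subtype hML', hM₁']
  have hlS' : len A S' = 1 := by rw [len_comap_subtype hSM, hS]
  have hT : len A (L ⧸ ML') = 1 := by
    have := len_quotient_add ML'
    omega
  have hTs : IsSimpleModule A (L ⧸ ML') := isSimple_of_len hT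
  have hZ : len A (M₁ ⧸ S') = 2 := by
    have := len_quotient_add S'
    omega
  have hZu : IsUniformModule A (M₁ ⧸ S') := uniform_quotient hS hSM hU hN₁ hNM
  let k : L →ₗ[A] L ⧸ ML' := ML'.mkQ
  have hk : ∀ x, k x = 0 ↔ (x : X) ∈ M₁' := fun x => by simp [k, ML']
  let k' : M₁ ⧸ S' →ₗ[A] L ⧸ ML' := S'.liftQ (k ∘ₗ Submodule.inclusion hML) (fun x hx =>
    (hk _).mpr (hSM' hx))
  have hkk' : ∀ x : M₁, k' (S'.mkQ x) = k (Submodule.inclusion hML x) := fun x => rfl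
  obtain ⟨x, hxM, hxM'⟩ := SetLike.not_le_iff_exists.mp
    (fun h : M₁ ≤ M₁' => hne (eq_of_len_le h (by omega)))
  have hkx : k ⟨x, hML hxM⟩ ≠ 0 := fun h => hxM' ((hk _).mp h)
  have hk'x : k' (S'.mkQ ⟨x, hxM⟩) ≠ 0 := hkx
  rcases exists_factor_of_submodule H (hX.submodule L) hZu (by omega) k k'
    (surjective_of_ne_zero k' hk'x) (B := ML)
    (fun h => by rw [h, len_top] at hlML; omega) ⟨⟨x, hML hxM⟩, hxM, hkx⟩ with ⟨s, hs⟩ | ⟨s, hs⟩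
  · have hlker : len A (LinearMap.ker k') = 1 := by
      have h1 := len_range_add k'
      rw [LinearMap.range_eq_top.mpr (surjective_of_ne_zero k' hk'x), len_top] at h1
      omega
    have h2 : len A (ML'.map s) ≤ 1 := by
      rw [← hlker]
      apply len_le
      rintro _ ⟨y, hy, rfl⟩
      rw [LinearMap.mem_ker, hs]
      exact (hk y).mpr hy
    have h3 := len_map_add s ML'
    obtain ⟨B, hB, hB2⟩ := exists_len_le (ML' ⊓ LinearMap.ker s) (n := 2) (by omega)
    have hBN : B.map L.subtype = N₁ := by
      refine hU' _ ?_ (by rw [len_map_of_injective _ L.subtype_injective, hB2])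
      rintro _ ⟨b, hb, rfl⟩
      exact (hB hb).1
    have hBM : B ≤ ML ⊓ LinearMap.ker s := fun b hb =>
      ⟨hNM (hBN ▸ Submodule.mem_map_of_mem hb), (hB hb).2⟩
    have h4 := len_map_add s ML
    have h5 := len_le hBM
    have h6 : ML.map s ≤ LinearMap.ker k' :=
      hZu.le_of_len (by omega) (ne_bot_of_len (by omega))
    have h7 : k' (s ⟨x, hML hxM⟩) = 0 := h6 ⟨⟨x, hML hxM⟩, hxM, rfl⟩
    exact (hkx (by rw [← hs, h7])).elim
  · refine ⟨L.subtype ∘ₗ s ∘ₗ S'.mkQ, fun y => ⟨(s _).2, fun hy => ?_, ?_⟩⟩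
    · have : S'.mkQ y = 0 := (Submodule.Quotient.mk_eq_zero S').mpr hy
      simp [this]
    · have h1 := hs (S'.mkQ y)
      rw [hkk', ← sub_eq_zero, ← map_sub, hk] at h1
      exact h1

end LengthFive

section LengthFiveStructure

variable {A : Type v} [Ring A]
variable {X : Type w} [AddCommGroup X] [Module A X] [IsArtinian A X] [IsNoetherian A X]

lemma map_mkQ_sup_left (N N' : Submodule A X) : (N ⊔ N').map N.mkQ = N'.map N.mkQ := by
  rw [Submodule.map_sup, Submodule.mkQ_map_self, bot_sup_eq]

lemma map_mkQ_sup_right (N N' : Submodule A X) : (N ⊔ N').map N'.mkQ = N.map N'.mkQ := by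
  rw [sup_comm, map_mkQ_sup_left]

lemma eq_of_two_uniserial (H : NonlocalBound.{v, w} A) (hX : IsUniformModule A X)
    (h5 : len A X = 5) {L M₁ M₁' N₁ : Submodule A X} (hL : len A L = 4)
    (hLtop : ∀ Z : Submodule A X, Z ≠ ⊤ → Z ≤ L) (hN₁ : len A N₁ = 2)
    (hN : ∀ C : Submodule A X, len A C = 3 → N₁ ≤ C) (hM₁ : len A M₁ = 3)
    (hM₁' : len A M₁' = 3) (hU : ∀ B ≤ M₁, len A B = 2 → B = N₁)
    (hU' : ∀ B ≤ M₁', len A B = 2 → B = N₁) : M₁ = M₁' := by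
  by_contra hne
  have hle : ∀ {Z : Submodule A X}, len A Z < 5 → Z ≤ L := fun h =>
    hLtop _ fun h' => by rw [h', len_top] at h; omega
  obtain ⟨S, -, hS⟩ := exists_len_le (⊤ : Submodule A X) (n := 1) (by rw [len_top]; omega)
  have hSle : ∀ {Z : Submodule A X}, 0 < len A Z → S ≤ Z := fun h =>
    hX.le_of_len hS.le (ne_bot_of_len h)
  have hinv := mem_iff_of_len_three hN₁ hM₁ hM₁' hne hN
  have hNM := hN M₁ hM₁
  obtain ⟨ψ, hψ⟩ := exists_of_two_uniserial H hX hL hM₁ hM₁' hne hN₁ hS (hle (by omega))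
    (hle (by omega)) hNM hU hU'
  set N₂ := LinearMap.range ψ with hN₂def
  have hSker : S.comap M₁.subtype ≤ LinearMap.ker ψ := fun x hx => (hψ x).2.1 hx
  have hlS : len A (S.comap M₁.subtype) = 1 := by
    rw [len_comap_subtype (hSle (by omega)), hS]
  have hrange := len_range_add ψ
  rw [hM₁, ← hN₂def] at hrange
  have hN₂N₁ : ¬ N₂ ≤ N₁ := by
    intro h
    refine hne (eq_of_len_le (fun x hx => ?_) (by omega))
    have h1 : ψ ⟨x, hx⟩ ∈ M₁' := hN M₁' hM₁' (h ⟨_, rfl⟩)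
    have h2 := sub_mem h1 (hψ ⟨x, hx⟩).2.2
    rwa [sub_sub_cancel] at h2
  have hlN₂ : len A N₂ = 2 := by
    have h1 := len_le hSker
    by_contra h
    exact hN₂N₁ (hX.le_of_len (by omega) (ne_bot_of_len (by omega)))
  have hne₂ : N₁ ≠ N₂ := fun h => hN₂N₁ h.ge
  have hker : LinearMap.ker ψ = S.comap M₁.subtype := (eq_of_len_le hSker (by omega)).symm
  obtain ⟨hinf, hlK⟩ := hX.len_inf_sup hN₁ hlN₂ hne₂
  have hinfS : N₁ ⊓ N₂ = S := (eq_of_len_le (hSle (by omega)) (by omega)).symm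
  set K := N₁ ⊔ N₂ with hKdef
  obtain ⟨g, hg⟩ := hX.exists_extend H (by omega) N₁ (ψ ∘ₗ Submodule.inclusion hNM)
  have hgN : ∀ x (hx : x ∈ N₁), g x = ψ ⟨x, hNM hx⟩ := fun x hx => hg ⟨x, hx⟩
  have hg0 : ∀ x ∈ N₁, g x = 0 ↔ x ∈ S := fun x hx => by
    rw [hgN x hx, ← LinearMap.mem_ker, hker]; rfl
  have hNker : N₁ ⊓ LinearMap.ker g = S := by
    ext x
    exact ⟨fun h => (hg0 x h.1).mp h.2, fun h =>
      ⟨hSle (by omega) h, (hg0 x (hSle (by omega) h)).mpr h⟩⟩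
  have hNkerg : ¬ N₁ ≤ LinearMap.ker g := fun h => by
    rw [inf_eq_left.mpr h] at hNker
    rw [hNker] at hN₁; omega
  have hNmap : N₁.map g = S := by
    have := len_map_add g N₁
    rw [hNker] at this
    exact (eq_of_len_le (hSle (by omega)) (by omega)).symm
  have hkerL : LinearMap.ker g ≤ L := hLtop _ fun h => hNkerg (h ▸ le_top)
  have hlker : len A (LinearMap.ker g) = 1 ∨ len A (LinearMap.ker g) = 2 := by
    have h1 := len_le (hNker ▸ inf_le_right : S ≤ LinearMap.ker g)
    by_contra! h
    obtain ⟨C, hC, hC3⟩ := exists_len_le (LinearMap.ker g) (n := 3) (by omega)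
    exact hNkerg ((hN C hC3).trans hC)
  have hlr := len_range_add g
  have hlL := len_map_add g L
  rw [inf_eq_right.mpr hkerL] at hlL
  have himage : ∀ {Z : Submodule A X}, Z < LinearMap.range g → Z ≤ L.map g := by
    intro Z hZ
    rw [← Submodule.map_comap_eq_of_le hZ.le]
    refine Submodule.map_mono (hLtop _ fun h => hZ.not_ge ?_)
    rintro _ ⟨x, rfl⟩
    have : x ∈ Z.comap g := h ▸ trivial
    exact this
  have hlker2 : len A (LinearMap.ker g) = 2 := by
    refine hlker.resolve_left fun h => ?_
    have hrL : LinearMap.range g = L := eq_of_len_le (hle (by omega)) (by omega)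
    have hsub : ∀ {C : Submodule A X}, len A C = 3 → C ≤ L.map g := fun hC =>
      himage (lt_of_le_of_ne (hrL ▸ hle (by omega)) fun h' => by rw [h'] at hC; omega)
    have h1 := len_sup_of_len_eq (hM₁.trans hM₁'.symm) hne
    have h2 := len_le (sup_le (hsub hM₁) (hsub hM₁'))
    omega
  have hLN : L.map g = N₁ := by
    refine (eq_of_len_le (himage (lt_of_le_of_ne (hN _ (by omega)) fun h => ?_)) (by omega)).symm
    rw [← h] at hlr; omega
  let C := L ⊓ S.comap g
  have hgC : C.map g = S := by
    apply le_antisymm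
    · rintro _ ⟨x, hx, rfl⟩; exact hx.2
    · intro y hy
      have h1 : y ∈ L.map g := by rw [hLN]; exact hSle (by omega) hy
      obtain ⟨x, hx, rfl⟩ := h1
      exact ⟨x, ⟨hx, hy⟩, rfl⟩
  have hkC : LinearMap.ker g ≤ C := le_inf hkerL fun x hx => by
    rw [Submodule.mem_comap, LinearMap.mem_ker.mp hx]; exact S.zero_mem
  have hlC : len A C = 3 := by
    have := len_map_add g C
    rw [inf_eq_right.mpr hkC, hgC] at this
    omega
  have hinfC : ∀ {Z : Submodule A X}, len A Z = 3 → Z ≠ C → Z ⊓ C = N₁ ∧ Z.map g = N₁ := by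
    intro Z hZ hZC
    constructor
    · have := len_inf_of_len_eq (hZ.trans hlC.symm) hZC
      exact (eq_of_len_le (le_inf (hN _ hZ) (hN _ hlC)) (by omega)).symm
    · have hZL : Z ≤ L := hle (by omega)
      refine eq_of_len_le (hLN ▸ Submodule.map_mono hZL) ?_
      by_contra h
      have h1 : Z.map g ≤ S := hX.le_of_len (by omega) (ne_bot_of_len (by omega))
      exact hZC (eq_of_len_le (fun x hx => ⟨hZL hx, h1 ⟨x, hx, rfl⟩⟩) (by omega))
  have hker₂ : ∀ {Z : Submodule A X}, len A Z = 3 → Z ≠ C → ∀ x : Z,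
      (N₂.mkQ ∘ₗ g ∘ₗ Z.subtype) x = 0 ↔ (x : X) ∈ N₁ := by
    intro Z hZ hZC x
    have hZL : Z ≤ L := hle (by omega)
    have h1 : (x : X) ∈ N₁ ↔ g x ∈ S := by
      rw [← (hinfC hZ hZC).1]
      exact ⟨fun h => h.2.2, fun h => ⟨x.2, hZL x.2, h⟩⟩
    have h2 : g x ∈ N₁ := hLN ▸ Submodule.mem_map_of_mem (hZL x.2)
    rw [h1, ← hinfS]
    simp [h2]
  have hrange₂ : ∀ {Z : Submodule A X}, len A Z = 3 → Z ≠ C →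
      LinearMap.range (N₂.mkQ ∘ₗ g ∘ₗ Z.subtype) = K.map N₂.mkQ := by
    intro Z hZ hZC
    rw [LinearMap.range_comp, LinearMap.range_comp, Submodule.range_subtype,
      (hinfC hZ hZC).2, hKdef, map_mkQ_sup_right]
  by_cases hCK : K = C
  · have hM₁C : M₁ ≠ C := by
      rw [← hCK]
      intro h
      exact hne₂ (hU N₂ (h ▸ le_sup_right) hlN₂).symm
    refine false_of_quotients H hX (by omega) hlK hN₁ hlN₂ hne₂ le_sup_left le_sup_right hinv
      (N₁.mkQ ∘ₗ ψ) (N₂.mkQ ∘ₗ g ∘ₗ M₁.subtype) ?_ ?_ (hrange₂ hM₁ hM₁C)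
    · have h1 : LinearMap.ker (N₂.mkQ ∘ₗ g ∘ₗ M₁.subtype) = N₁.comap M₁.subtype := by
        ext x; exact hker₂ hM₁ hM₁C x
      rw [h1]
      have h2 : len A (LinearMap.ker (N₁.mkQ ∘ₗ ψ)) = 2 := by
        have e1 := len_range_add (N₁.mkQ ∘ₗ ψ)
        have e2 := len_map_add N₁.mkQ K
        rw [LinearMap.range_comp, ← hN₂def, ← map_mkQ_sup_left, ← hKdef] at e1
        rw [Submodule.ker_mkQ, inf_eq_right.mpr le_sup_left] at e2
        omega
      have h3 := hU _ (Submodule.map_subtype_le M₁ (LinearMap.ker (N₁.mkQ ∘ₗ ψ)))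
        (by rw [len_map_of_injective _ M₁.subtype_injective, h2])
      have h4 := congrArg (Submodule.comap M₁.subtype) h3
      rwa [Submodule.comap_map_eq_of_injective M₁.subtype_injective] at h4
    · rw [LinearMap.range_comp, ← hN₂def, ← map_mkQ_sup_left]
  · refine false_of_quotients H hX (by omega) hlK hN₁ hlN₂ hne₂ le_sup_left le_sup_right hinv
      (N₁.mkQ ∘ₗ K.subtype) (N₂.mkQ ∘ₗ g ∘ₗ K.subtype) ?_ ?_ (hrange₂ hlK hCK)
    · ext x
      rw [LinearMap.mem_ker, LinearMap.mem_ker, hker₂ hlK hCK]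
      simp
    · rw [LinearMap.range_comp, Submodule.range_subtype]

/-- The submodules of length two and three of a uniform module of length five. -/
theorem exists_of_len_five {R : Type*} [CommRing R] [IsArtinianRing R] [Algebra R A]
    [Module.Finite R A] (H : NonlocalBound.{v, w} A) (hX : IsUniformModule A X)
    (h5 : len A X = 5) {C₁ C₂ : Submodule A X} (hC₁ : len A C₁ = 3) (hC₂ : len A C₂ = 3)
    (hne : C₁ ≠ C₂) :
    ∃ M₁ M₂ N₁ N₂ : Submodule A X, len A M₁ = 3 ∧ len A M₂ = 3 ∧ len A N₁ = 2 ∧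
      len A N₂ = 2 ∧ M₁ ≠ M₂ ∧ N₁ ≠ N₂ ∧ N₁ ≤ M₁ ∧ N₁ ≤ M₂ ∧ N₂ ≤ M₂ ∧ ¬ N₂ ≤ M₁ ∧
      (∀ Z : Submodule A X, len A Z = 3 → Z = M₁ ∨ Z = M₂) ∧
      (∀ Z : Submodule A X, len A Z = 2 → Z = N₁ ∨ Z = N₂) := by
  set L := C₁ ⊔ C₂ with hLdef
  have hL : len A L = 4 := by
    have h1 : len A C₁ < len A L := len_sup_of_len_eq (hC₁.trans hC₂.symm) hne
    have h2 : len A L ≤ 4 := hX.len_sup_le H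
      (fun h => hne (eq_of_len_le h (by omega))) (fun h => hne (eq_of_len_le h (by omega)).symm)
    omega
  have hLtop : ∀ Z : Submodule A X, Z ≠ ⊤ → Z ≤ L := by
    intro Z hZ
    by_contra h
    by_cases h' : L ≤ Z
    · have h1 := len_lt (lt_of_le_of_ne h' fun e => h e.ge)
      exact hZ (eq_top_of_len (by omega))
    · have h1 := hX.len_sup_le H h h'
      exact h (sup_eq_right.mp (eq_of_len_le le_sup_right (by omega)).symm)
  have hle : ∀ {Z : Submodule A X}, len A Z < 5 → Z ≤ L := fun h =>
    hLtop _ fun h' => by rw [h', len_top] at h; omega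
  obtain ⟨N₁, hN₁def⟩ : ∃ N, N = C₁ ⊓ C₂ := ⟨_, rfl⟩
  have hN₁ : len A N₁ = 2 := by
    have := len_sup_add_inf C₁ C₂
    rw [← hLdef, ← hN₁def] at this
    omega
  have hN : ∀ C : Submodule A X, len A C = 3 → N₁ ≤ C := by
    intro C hC
    have hcl : ∀ {Z : Submodule A X}, len A Z = 3 → len A (Z.comap L.subtype) = 3 := fun h => by
      rw [len_comap_subtype (hle (by omega)), h]
    have := inf_le_of_len_three R H (hX.submodule L) hL (hcl hC₁) (hcl hC₂) (hcl hC)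
      (fun h => hne (comap_subtype_injOn (hle (by omega)) (hle (by omega)) h))
    intro x hx
    rw [hN₁def] at hx
    exact this (x := ⟨x, le_sup_left (a := C₁) hx.1⟩) ⟨hx.1, hx.2⟩
  have hinv := mem_iff_of_len_three hN₁ hC₁ hC₂ hne hN
  have huni : ∀ {M₁ M₁' : Submodule A X}, len A M₁ = 3 → len A M₁' = 3 →
      (∀ B ≤ M₁, len A B = 2 → B = N₁) → (∀ B ≤ M₁', len A B = 2 → B = N₁) → M₁ = M₁' :=
    fun h h' => eq_of_two_uniserial H hX h5 hL hLtop hN₁ hN h h'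
  obtain ⟨K, hK, hKn⟩ : ∃ K : Submodule A X, len A K = 3 ∧
      ¬ ∀ B ≤ K, len A B = 2 → B = N₁ := by
    by_contra! h
    exact hne (huni hC₁ hC₂ (h _ hC₁) (h _ hC₂))
  push Not at hKn
  obtain ⟨N₂, hN₂K, hN₂, hN₂₁⟩ := hKn
  have hsup : ∀ {Z Z' : Submodule A X}, len A Z = 2 → len A Z' = 3 → Z ≤ Z' → Z ≠ N₁ →
      N₁ ⊔ Z = Z' := fun hZ hZ' hle hZn =>
    eq_of_len_le (sup_le (hN _ hZ') hle) (by
      have := (hX.len_inf_sup hN₁ hZ hZn.symm).2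
      omega)
  have hKuniq : ∀ {Z Z' : Submodule A X}, len A Z = 2 → len A Z' = 3 → Z ≤ Z' → Z ≠ N₁ →
      Z' = K := by
    intro Z Z' hZ hZ' hle hZn
    by_cases hZN₂ : Z = N₂
    · rw [← hsup hZ hZ' hle hZn, hZN₂, hsup hN₂ hK hN₂K hN₂₁]
    · have h1 := (hX.len_inf_sup hZ hN₂ hZN₂).2
      have h2 := hN _ h1
      have h3 : N₁ ⊔ Z = Z ⊔ N₂ := hsup hZ h1 le_sup_left hZn
      have h4 : N₁ ⊔ N₂ = Z ⊔ N₂ := hsup hN₂ h1 le_sup_right hN₂₁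
      rw [← hsup hZ hZ' hle hZn, ← hsup hN₂ hK hN₂K hN₂₁, h3, h4]
  have hNU : ∀ {Z : Submodule A X}, len A Z = 3 → Z ≠ K → ∀ B ≤ Z, len A B = 2 → B = N₁ := by
    intro Z hZ hZK B hB hB2
    by_contra h
    exact hZK (hKuniq hB2 hZ hB h)
  obtain ⟨M₁, hM₁, hM₁K⟩ : ∃ M₁ : Submodule A X, len A M₁ = 3 ∧ M₁ ≠ K := by
    by_cases h : C₁ = K
    · exact ⟨C₂, hC₂, fun h' => hne (h.trans h'.symm)⟩
    · exact ⟨C₁, hC₁, h⟩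
  refine ⟨M₁, K, N₁, N₂, hM₁, hK, hN₁, hN₂, hM₁K, hN₂₁.symm, hN _ hM₁, hN _ hK, hN₂K,
    fun h => hN₂₁ (hNU hM₁ hM₁K _ h hN₂), fun Z hZ => ?_, fun Z hZ => ?_⟩
  · by_contra! h
    exact h.1 (huni hZ hM₁ (hNU hZ h.2) (hNU hM₁ hM₁K))
  · by_contra! h
    have h1 : N₁ ⊔ Z = K := hKuniq hZ (hX.len_inf_sup hN₁ hZ h.1.symm).2 le_sup_right h.1
    have hN₁₂ : N₁ ⊔ N₂ = K := hsup hN₂ hK hN₂K hN₂₁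
    have hZ₂ : Z ⊔ N₂ = K := hKuniq hZ (hX.len_inf_sup hZ hN₂ h.2).2 le_sup_left h.1
    obtain ⟨S, -, hS⟩ := exists_len_le (⊤ : Submodule A X) (n := 1) (by rw [len_top]; omega)
    have hinfS : ∀ {B : Submodule A X}, len A B = 2 → Z ≠ B → Z ⊓ B = S := fun hB hZB => by
      have e := (hX.len_inf_sup hZ hB hZB).1
      exact (eq_of_len_le (hX.le_of_len hS.le (ne_bot_of_len (by omega))) (by omega)).symm
    refine false_of_quotients H hX (by omega) hK hN₁ hN₂ hN₂₁.symm (hN _ hK) hN₂K hinv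
      (N₁.mkQ ∘ₗ Z.subtype) (N₂.mkQ ∘ₗ Z.subtype) ?_ ?_ ?_
    · have e : Z ⊓ N₁ = Z ⊓ N₂ := (hinfS hN₁ h.1).trans (hinfS hN₂ h.2).symm
      ext x
      have e' : (x : X) ∈ Z ⊓ N₁ ↔ (x : X) ∈ Z ⊓ N₂ := by rw [e]
      simpa using e'
    · rw [LinearMap.range_comp, Submodule.range_subtype, ← h1, map_mkQ_sup_left]
    · rw [LinearMap.range_comp, Submodule.range_subtype, ← hZ₂, map_mkQ_sup_right]

end LengthFiveStructure

section Radical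

variable {A : Type v} [Ring A]
variable {M : Type w} [AddCommGroup M] [Module A M] [IsArtinian A M] [IsNoetherian A M]

lemma isCoatom_of_len {Y : Submodule A M} (h : len A Y + 1 = len A M) : IsCoatom Y := by
  refine ⟨fun h' => ?_, fun Z hZ => eq_top_of_len ?_⟩
  · rw [h', len_top] at h; omega
  · have := len_lt hZ; omega

lemma map_subtype_lt {N : Submodule A M} {D : Submodule A N} (hD : D ≠ ⊤) :
    D.map N.subtype < N := by
  refine lt_of_le_of_ne (Submodule.map_subtype_le N D) fun h => hD ?_
  rw [eq_top_iff]
  intro x _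
  have hx : (x : M) ∈ D.map N.subtype := h.symm ▸ x.2
  obtain ⟨y, hy, hyx⟩ := hx
  rwa [← N.subtype_injective hyx]

lemma exists_len_ge {Z N : Submodule A M} (h : Z < N) :
    ∃ C, Z ≤ C ∧ C ≤ N ∧ len A C + 1 = len A N := by
  obtain ⟨C, hZC, hC⟩ := exists_coatom_ge (Y := Z.comap N.subtype)
    (fun h' => h.not_ge (Submodule.comap_subtype_eq_top.mp h'))
  refine ⟨C.map N.subtype, ?_, Submodule.map_subtype_le _ _, ?_⟩
  · intro z hz
    exact ⟨⟨z, h.le hz⟩, hZC hz, rfl⟩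
  · rw [len_map_of_injective _ N.subtype_injective, len_of_isCoatom hC]

lemma radOf_le (N : Submodule A M) : radOf N ≤ N := Submodule.map_subtype_le _ _

lemma radOf_eq {C N : Submodule A M} (hC : C < N) (h : ∀ Z < N, Z ≤ C) : radOf N = C := by
  have hle : ∀ D : Submodule A N, D ≠ ⊤ → D ≤ C.comap N.subtype := fun D hD =>
    Submodule.map_le_iff_le_comap.mp (h _ (map_subtype_lt hD))
  have hne : C.comap N.subtype ≠ ⊤ := fun h' =>
    hC.not_ge (Submodule.comap_subtype_eq_top.mp h')
  have hrad : moduleRad A N = C.comap N.subtype := by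
    apply le_antisymm
    · refine sInf_le ⟨hne, fun D hD => ?_⟩
      by_contra hD'
      exact hD.not_ge (hle D hD')
    · refine le_sInf fun D hD => ?_
      rcases (hle D hD.1).eq_or_lt with h' | h'
      · exact h'.ge
      · exact (hne (hD.2 _ h')).elim
  rw [radOf, hrad, Submodule.map_comap_subtype, inf_eq_right.mpr hC.le]

lemma radPow_succ_le (n : ℕ) {Y : Submodule A M} (hY : IsCoatom Y) :
    radPow A M (n + 1) ≤ Y := by
  have anti : radPow A M (n + 1) ≤ radPow A M 1 := by
    induction n with
    | zero => exact le_rfl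
    | succ n ih => exact (radOf_le _).trans ih
  refine anti.trans ?_
  have hY' : IsCoatom (Y.comap (⊤ : Submodule A M).subtype) := by
    apply isCoatom_of_len
    rw [len_comap_subtype le_top, len_top]
    exact len_of_isCoatom hY
  rintro _ ⟨x, hx, rfl⟩
  exact (sInf_le hY' : moduleRad A (⊤ : Submodule A M) ≤ _) hx

lemma isUniserial_quotient_iff (K : Submodule A M) : IsUniserialModule A (M ⧸ K) ↔
    ∀ Y Z : Submodule A M, K ≤ Y → K ≤ Z → Y ≤ Z ∨ Z ≤ Y := by
  constructor
  · intro h Y Z hY hZ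
    have key : ∀ {Y Z : Submodule A M}, K ≤ Z → Y.map K.mkQ ≤ Z.map K.mkQ → Y ≤ Z := by
      intro Y Z hZ h
      rw [Submodule.map_le_iff_le_comap, Submodule.comap_map_mkQ, sup_eq_right.mpr hZ] at h
      exact h
    exact (h (Y.map K.mkQ) (Z.map K.mkQ)).imp (key hZ) (key hY)
  · intro h Y Z
    have key : ∀ {Y Z : Submodule A (M ⧸ K)}, Y.comap K.mkQ ≤ Z.comap K.mkQ → Y ≤ Z := by
      intro Y Z h q hq
      obtain ⟨x, rfl⟩ := K.mkQ_surjective q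
      exact h hq
    exact (h _ _ (Submodule.le_comap_mkQ K Y) (Submodule.le_comap_mkQ K Z)).imp key key

lemma isNFactorSerial_of_coatoms {C C' : Submodule A M} (hC : IsCoatom C) (hC' : IsCoatom C')
    (hne : C ≠ C') {n : ℕ} (hn : len A M = n) (h1 : 1 < n) : IsNFactorSerial A M n := by
  have hinc : ¬ (C ≤ C' ∨ C' ≤ C) := by
    rintro (h | h)
    · exact hne ((hC.le_iff_eq hC'.1).mp h).symm
    · exact hne ((hC'.le_iff_eq hC.1).mp h)
  refine ⟨h1, fun h => hinc (h C C'), n, by rw [moduleLength_eq, hn], le_rfl, ?_, ?_⟩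
  · rw [isUniserial_quotient_iff, Nat.sub_self]
    intro Y Z _ hZ
    exact Or.inl (le_top.trans hZ)
  · rw [isUniserial_quotient_iff, Nat.sub_self]
    intro h
    exact hinc (h C C' (radPow_succ_le 0 hC) (radPow_succ_le 0 hC'))

lemma not_isLocal_of_coatoms {C C' : Submodule A M} (hC : IsCoatom C) (hC' : IsCoatom C')
    (hne : C ≠ C') : ¬ IsLocalModule A M := fun h => hne (h.unique hC hC')

lemma isNFactorSerial_of_two_maximal {W C C' : Submodule A M} (hC : C ≤ W) (hC' : C' ≤ W)
    (hl : len A C + 1 = len A W) (hl' : len A C' + 1 = len A W) (hne : C ≠ C') {n : ℕ}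
    (hn : len A W = n) (h1 : 1 < n) : ¬ IsLocalModule A W ∧ IsNFactorSerial A W n := by
  have hc : IsCoatom (C.comap W.subtype) :=
    isCoatom_of_len (by rw [len_comap_subtype hC, hl])
  have hc' : IsCoatom (C'.comap W.subtype) :=
    isCoatom_of_len (by rw [len_comap_subtype hC', hl'])
  have hne' : C.comap W.subtype ≠ C'.comap W.subtype := fun h =>
    hne (comap_subtype_injOn hC hC' h)
  exact ⟨not_isLocal_of_coatoms hc hc' hne', isNFactorSerial_of_coatoms hc hc' hne' hn h1⟩

lemma moduleSoc_le (h : IsColocalModule A M) {Z : Submodule A M} (hZ : Z ≠ ⊥) :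
    moduleSoc A M ≤ Z := by
  obtain ⟨S, hS, hSZ⟩ := (eq_bot_or_exists_atom_le Z).resolve_left hZ
  have h1 : S ≤ moduleSoc A M := le_sSup hS
  rw [← (h.le_iff_eq hS.1).mp h1]
  exact hSZ

lemma IsColocalModule.isUniform (h : IsColocalModule A M) : IsUniformModule A M := by
  intro Y Z hY hZ h0
  have := le_inf (moduleSoc_le h hY) (moduleSoc_le h hZ)
  rw [h0, le_bot_iff] at this
  exact h.1 this

lemma IsUniformModule.isUniserial (hM : IsUniformModule A M) {W : Submodule A M}
    (hW : len A W ≤ 3) (hU : ∀ B ≤ W, ∀ B' ≤ W, len A B = 2 → len A B' = 2 → B = B') :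
    IsUniserialModule A W := by
  have key : ∀ Y ≤ W, ∀ Z ≤ W, Y ≤ Z ∨ Z ≤ Y := by
    have two : ∀ {Y Z : Submodule A M}, Y ≤ W → Z ≤ W → ¬ Y ≤ Z → ¬ Z ≤ Y →
        len A Y = 2 := by
      intro Y Z hY hZ h h'
      have hZ0 : Z ≠ ⊥ := fun e => h' (e ▸ bot_le)
      have h1 : ¬ len A Y ≤ 1 := fun e => h (hM.le_of_len e hZ0)
      have h2 := len_lt (lt_of_le_of_ne hY fun e => h' (e ▸ hZ))
      omega
    intro Y hY Z hZ
    by_contra! h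
    exact h.1 (hU Y hY Z hZ (two hY hZ h.1 h.2) (two hZ hY h.2 h.1)).le
  intro Y Z
  have inj : ∀ {Y Z : Submodule A W}, Y.map W.subtype ≤ Z.map W.subtype → Y ≤ Z := fun h =>
    (Submodule.map_le_map_iff_of_injective W.subtype_injective _ _).mp h
  exact (key _ (Submodule.map_subtype_le W Y) _ (Submodule.map_subtype_le W Z)).imp inj inj

lemma IsUniformModule.le_of_five_le (H : NonlocalBound.{v, w} A) (hM : IsUniformModule A M)
    {Y Z : Submodule A M} (hY : 5 ≤ len A Y) (hZ : len A Z ≤ len A Y) : Z ≤ Y := by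
  by_contra h
  have h' : ¬ Y ≤ Z := fun e => h (eq_of_len_le e hZ).ge
  have h1 := hM.len_sup_le H h h'
  have h2 := len_le (le_sup_right : Y ≤ Z ⊔ Y)
  omega

lemma IsUniformModule.radOf_of_five_le (H : NonlocalBound.{v, w} A)
    (hM : IsUniformModule A M) {N : Submodule A M} (hN : 5 ≤ len A N) :
    len A (radOf N) + 1 = len A N ∧ ∀ Z < N, Z ≤ radOf N := by
  have hbot : ⊥ < N := bot_lt_iff_ne_bot.mpr (ne_bot_of_len (by omega))
  obtain ⟨C, -, hCN, hC⟩ := exists_len_ge hbot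
  have hlt : C < N := lt_of_le_of_ne hCN fun h => by rw [h] at hC; omega
  have hmax : ∀ Z < N, Z ≤ C := by
    intro Z hZ
    by_contra h
    have h1 := len_lt hZ
    have h' : ¬ C ≤ Z := fun e => h (eq_of_len_le e (by omega)).ge
    have h2 := hM.len_sup_le H h h'
    have h3 := len_lt (lt_of_le_of_ne (le_sup_right : C ≤ Z ⊔ C) fun e => h (e ▸ le_sup_left))
    omega
  rw [radOf_eq hlt hmax]
  exact ⟨hC, hmax⟩

lemma IsUniformModule.len_radPow (H : NonlocalBound.{v, w} A) (hM : IsUniformModule A M)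
    (i : ℕ) (hi : i + 4 ≤ len A M) : len A (radPow A M i) + i = len A M := by
  induction i with
  | zero => exact len_top
  | succ i ih =>
    have h1 := ih (by omega)
    have h2 := (hM.radOf_of_five_le H (N := radPow A M i) (by omega)).1
    change len A (radOf (radPow A M i)) + _ = _
    omega

/-- A uniform four-factor serial module of length at least five has two submodules of length
three. -/
lemma exists_ne_of_isNFactorSerial (H : NonlocalBound.{v, w} A) (hM : IsUniformModule A M)
    (h5 : 5 ≤ len A M) (hfs : IsNFactorSerial A M 4) :
    ∃ C₁ C₂ : Submodule A M, len A C₁ = 3 ∧ len A C₂ = 3 ∧ C₁ ≠ C₂ := by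
  obtain ⟨-, -, l, hl, -, -, hns⟩ := hfs
  have hl' : len A M = l := by
    rw [moduleLength_eq] at hl
    exact_mod_cast hl
  rw [isUniserial_quotient_iff, ← hl'] at hns
  push Not at hns
  obtain ⟨Y, Z, hY, hZ, hYZ, hZY⟩ := hns
  have hL := hM.len_radPow H (len A M - 4) (by omega)
  set L := radPow A M (len A M - 4) with hLdef
  obtain ⟨C, -, hCL, hC⟩ := exists_len_ge (bot_lt_iff_ne_bot.mpr
    (ne_bot_of_len (by omega)) : ⊥ < L)
  by_contra! h
  have hrad : radOf L = C := by
    refine radOf_eq (lt_of_le_of_ne hCL fun e => by rw [e] at hC; omega) fun W hW => ?_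
    obtain ⟨C', hWC, -, hC'⟩ := exists_len_ge hW
    rwa [h C C' (by omega) (by omega)]
  have hY' : C ≤ Y := hrad ▸ hY
  have hZ' : C ≤ Z := hrad ▸ hZ
  have h1 := hM.len_sup_le H hYZ hZY
  have h2 := len_lt (lt_of_le_of_ne hY' fun e => hYZ (e ▸ hZ'))
  have h3 := len_lt (lt_of_le_of_ne (le_sup_left : Y ≤ Y ⊔ Z) fun e => hZY (e ▸ le_sup_right))
  omega

lemma exists_of_five_le {R : Type*} [CommRing R] [IsArtinianRing R] [Algebra R A]
    [Module.Finite R A] (H : NonlocalBound.{v, w} A) (hM : IsUniformModule A M)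
    (h5 : 5 ≤ len A M) {C₁ C₂ : Submodule A M} (hC₁ : len A C₁ = 3) (hC₂ : len A C₂ = 3)
    (hne : C₁ ≠ C₂) :
    ∃ M₁ M₂ N₁ N₂ : Submodule A M, len A M₁ = 3 ∧ len A M₂ = 3 ∧ len A N₁ = 2 ∧
      len A N₂ = 2 ∧ M₁ ≠ M₂ ∧ N₁ ≠ N₂ ∧ N₁ ≤ M₁ ∧ N₁ ≤ M₂ ∧ N₂ ≤ M₂ ∧ ¬ N₂ ≤ M₁ ∧
      (∀ Z : Submodule A M, len A Z = 3 → Z = M₁ ∨ Z = M₂) ∧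
      (∀ Z : Submodule A M, len A Z = 2 → Z = N₁ ∨ Z = N₂) := by
  obtain ⟨X, -, hX⟩ := exists_len_le (⊤ : Submodule A M) (n := 5) (by rw [len_top]; omega)
  have hle : ∀ {Z : Submodule A M}, len A Z ≤ 5 → Z ≤ X := fun h =>
    hM.le_of_five_le H hX.ge (by omega)
  have hinj := X.subtype_injective
  obtain ⟨M₁, M₂, N₁, N₂, hM₁, hM₂, hN₁, hN₂, hMM, hNN, h11, h12, h22, h21, h3, h2⟩ :=
    exists_of_len_five (R := R) H (hM.submodule X) hX
      (by rw [len_comap_subtype (hle (by omega)), hC₁])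
      (by rw [len_comap_subtype (hle (by omega)), hC₂])
      (fun h => hne (comap_subtype_injOn (hle (by omega)) (hle (by omega)) h))
  have back : ∀ {Z : Submodule A M} {Y : Submodule A X}, len A Z ≤ 5 →
      Z.comap X.subtype = Y → Z = Y.map X.subtype := by
    rintro Z _ hZ rfl
    rw [Submodule.map_comap_subtype, inf_eq_right.mpr (hle hZ)]
  have hli := fun Y => len_map_of_injective X.subtype hinj Y
  refine ⟨M₁.map X.subtype, M₂.map X.subtype, N₁.map X.subtype, N₂.map X.subtype,
    (hli _).trans hM₁, (hli _).trans hM₂, (hli _).trans hN₁, (hli _).trans hN₂,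
    fun h => hMM (Submodule.map_injective_of_injective hinj h),
    fun h => hNN (Submodule.map_injective_of_injective hinj h), Submodule.map_mono h11,
    Submodule.map_mono h12, Submodule.map_mono h22,
    fun h => h21 ((Submodule.map_le_map_iff_of_injective hinj _ _).mp h),
    fun Z hZ => ?_, fun Z hZ => ?_⟩
  · exact (h3 (Z.comap X.subtype) (by rw [len_comap_subtype (hle (by omega)), hZ])).imp
      (back (by omega)) (back (by omega))
  · exact (h2 (Z.comap X.subtype) (by rw [len_comap_subtype (hle (by omega)), hZ])).imp
      (back (by omega)) (back (by omega))

end Radical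

section LengthFive

variable {A : Type v} [Ring A]
variable {M : Type w} [AddCommGroup M] [Module A M] [IsArtinian A M] [IsNoetherian A M]

lemma IsUniformModule.quotient_of_len_three (H : NonlocalBound.{v, w} A)
    (hM : IsUniformModule A M) {M₁ : Submodule A M} (h₁ : len A M₁ = 3) :
    IsUniformModule A (M ⧸ M₁) := by
  intro Y Z hY hZ h0
  have lY := len_comap_mkQ M₁ Y
  have lZ := len_comap_mkQ M₁ Z
  have pY := len_pos hY
  have pZ := len_pos hZ
  have h := len_sup_add_inf (Y.comap M₁.mkQ) (Z.comap M₁.mkQ)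
  have hi : len A (Y.comap M₁.mkQ ⊓ Z.comap M₁.mkQ : Submodule A M) = 3 := by
    rw [← Submodule.comap_inf, len_comap_mkQ, h0, len_bot, h₁]
  have h1 := hM.len_sup_le H (Y := Y.comap M₁.mkQ) (Z := Z.comap M₁.mkQ)
    (fun e => by rw [inf_eq_left.mpr e] at hi; omega)
    (fun e => by rw [inf_eq_right.mpr e] at hi; omega)
  omega

lemma not_exists_map_quotient (H : NonlocalBound.{v, w} A) (hM : IsUniformModule A M)
    {M₁ M₂ C : Submodule A M} (h₁ : len A M₁ = 3) (h₂ : len A M₂ = 3) (hne : M₁ ≠ M₂)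
    (honly : ∀ Z : Submodule A M, len A Z = 3 → Z = M₁ ∨ Z = M₂)
    (hC : C ≠ ⊤) (hmax : ∀ Z : Submodule A M, Z ≠ ⊤ → Z ≤ C)
    (s : (M ⧸ M₁) →ₗ[A] M ⧸ M₂) (hs : ∀ x y, M₂.mkQ y = s (M₁.mkQ x) → y - x ∈ C) : False := by
  have hL := len_sup_of_len_eq (h₁.trans h₂.symm) hne
  have hL' := hM.len_sup_le H (fun e => hne (eq_of_len_le e (h₂.trans h₁.symm).le))
    (fun e => hne (eq_of_len_le e (h₁.trans h₂.symm).le).symm)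
  have k₁ := len_map_add M₁.mkQ (M₁ ⊔ M₂)
  have k₂ := len_map_add M₂.mkQ (M₁ ⊔ M₂)
  rw [Submodule.ker_mkQ, inf_eq_right.mpr le_sup_left] at k₁
  rw [Submodule.ker_mkQ, inf_eq_right.mpr le_sup_right] at k₂
  have ks := len_map_le s ((M₁ ⊔ M₂).map M₁.mkQ)
  have hle := (hM.quotient_of_len_three H h₂).le_of_len
    (S := ((M₁ ⊔ M₂).map M₁.mkQ).map s) (by omega)
    (ne_bot_of_len (Z := (M₁ ⊔ M₂).map M₂.mkQ) (by omega))
  let f : M →ₗ[A] M ⧸ M₂ := s ∘ₗ M₁.mkQ - M₂.mkQ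
  have hf : (M₁ ⊔ M₂).map f ≤ (M₁ ⊔ M₂).map M₂.mkQ := by
    rintro _ ⟨x, hx, rfl⟩
    exact Submodule.sub_mem _ (hle ⟨_, ⟨x, hx, rfl⟩, rfl⟩) ⟨x, hx, rfl⟩
  have kf := len_map_add f (M₁ ⊔ M₂)
  have kf' := len_le hf
  obtain ⟨Z, hZ, hZ3⟩ := exists_len_le ((M₁ ⊔ M₂) ⊓ LinearMap.ker f) (n := 3) (by omega)
  have hfZ : ∀ x ∈ Z, s (M₁.mkQ x) = M₂.mkQ x := fun x hx => sub_eq_zero.mp (hZ hx).2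
  rcases honly Z hZ3 with rfl | rfl
  · refine hne (eq_of_len_le (fun x hx => ?_) (h₂.trans h₁.symm).le)
    have h := hfZ x hx
    rw [(Submodule.Quotient.mk_eq_zero Z).mpr hx |> fun h : Z.mkQ x = 0 => h, map_zero] at h
    exact (Submodule.Quotient.mk_eq_zero M₂).mp h.symm
  · have hsur : Function.Surjective s := by
      rw [← LinearMap.range_eq_top]
      have htop : (LinearMap.range s).comap Z.mkQ = ⊤ := by
        by_contra hR
        refine hC ((Submodule.eq_top_iff').mpr fun x => ?_)
        obtain ⟨y, hy⟩ := Z.mkQ_surjective (s (M₁.mkQ x))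
        have h1 := hs x y hy
        have h2 : y ∈ C := hmax _ hR ⟨_, hy.symm⟩
        have := C.sub_mem h2 h1
        rwa [sub_sub_cancel] at this
      rw [eq_top_iff]
      intro q _
      obtain ⟨y, rfl⟩ := Z.mkQ_surjective q
      have : y ∈ (LinearMap.range s).comap Z.mkQ := htop ▸ Submodule.mem_top
      exact this
    have l₁ := len_quotient_add M₁
    have l₂ := len_quotient_add Z
    have hinj := injective_of_len s hsur (by omega)
    refine hne (eq_of_len_le (fun x hx => ?_) (h₁.trans h₂.symm).le).symm
    have h := hfZ x hx
    rw [(Submodule.Quotient.mk_eq_zero Z).mpr hx |> fun h : Z.mkQ x = 0 => h] at h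
    exact (Submodule.Quotient.mk_eq_zero M₁).mp (hinj (h.trans (map_zero s).symm))

lemma IsUniformModule.len_le_five (H : NonlocalBound.{v, w} A) (hM : IsUniformModule A M)
    {M₁ M₂ : Submodule A M} (h₁ : len A M₁ = 3) (h₂ : len A M₂ = 3) (hne : M₁ ≠ M₂)
    (honly : ∀ Z : Submodule A M, len A Z = 3 → Z = M₁ ∨ Z = M₂) : len A M ≤ 5 := by
  by_contra h6
  obtain ⟨hC, hmax⟩ := hM.radOf_of_five_le H (N := ⊤) (by rw [len_top]; omega)
  rw [len_top] at hC
  generalize radOf (⊤ : Submodule A M) = C at hC hmax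
  have hCt : C ≠ ⊤ := fun h => by rw [h, len_top] at hC; omega
  have hmax' : ∀ Z : Submodule A M, Z ≠ ⊤ → Z ≤ C := fun Z hZ => hmax Z hZ.lt_top
  have hM₁ : M₁ ≤ C := hmax' _ fun h => by rw [h, len_top] at h₁; omega
  have hM₂ : M₂ ≤ C := hmax' _ fun h => by rw [h, len_top] at h₂; omega
  have lT := len_quotient_add C
  have : IsSimpleModule A (M ⧸ C) := isSimple_of_len (by omega)
  have l₁ := len_quotient_add M₁
  have l₂ := len_quotient_add M₂
  have hL' := hM.len_sup_le H (fun e => hne (eq_of_len_le e (h₂.trans h₁.symm).le))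
    (fun e => hne (eq_of_len_le e (h₁.trans h₂.symm).le).symm)
  obtain ⟨y, hyC, hyL⟩ : ∃ y ∈ C, y ∉ M₁ ⊔ M₂ :=
    Set.not_subset.mp fun h : C ≤ M₁ ⊔ M₂ => by have := len_le h; omega
  obtain ⟨x, -, hxC⟩ : ∃ x ∈ (⊤ : Submodule A M), x ∉ C :=
    Set.not_subset.mp fun h : ⊤ ≤ C => hCt (top_le_iff.mp h)
  let k : (M ⧸ M₁) →ₗ[A] M ⧸ C := Submodule.factor hM₁
  let k' : (M ⧸ M₂) →ₗ[A] M ⧸ C := Submodule.factor hM₂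
  have hk : ∀ z, k (M₁.mkQ z) = C.mkQ z := fun _ => rfl
  have hk' : ∀ z, k' (M₂.mkQ z) = C.mkQ z := fun _ => rfl
  have hmem : ∀ z z' : M, C.mkQ z = C.mkQ z' → z - z' ∈ C := fun z z' h =>
    (Submodule.Quotient.eq C).mp h
  have hD : ∀ z ∈ LinearMap.range (M₁.mkQ.prod M₂.mkQ), k z.1 = k' z.2 := by
    rintro _ ⟨z, rfl⟩
    rfl
  have hne' : ∃ a b, k a = k' b ∧ (a, b) ∉ LinearMap.range (M₁.mkQ.prod M₂.mkQ) := by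
    refine ⟨M₁.mkQ y, 0, ?_, ?_⟩
    · rw [map_zero, hk]
      exact (Submodule.Quotient.mk_eq_zero C).mpr hyC
    · rintro ⟨z, hz⟩
      have e₁ : M₁.mkQ z = M₁.mkQ y := congrArg Prod.fst hz
      have e₂ : M₂.mkQ z = 0 := congrArg Prod.snd hz
      have m₁ : z - y ∈ M₁ := (Submodule.Quotient.eq M₁).mp e₁
      have m₂ : z ∈ M₂ := (Submodule.Quotient.mk_eq_zero M₂).mp e₂
      apply hyL
      have := (M₁ ⊔ M₂).sub_mem (Submodule.mem_sup_right m₂) (Submodule.mem_sup_left m₁)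
      rwa [sub_sub_cancel] at this
  have hd : ∃ d ∈ LinearMap.range (M₁.mkQ.prod M₂.mkQ), k d.1 ≠ 0 := by
    refine ⟨_, ⟨x, rfl⟩, fun h => hxC ?_⟩
    exact (Submodule.Quotient.mk_eq_zero C).mp h
  rcases exists_factor_of_pullback H (hM.quotient_of_len_three H h₁)
    (hM.quotient_of_len_three H h₂) k k' (by omega)
    _ hD hne' hd with ⟨s, hs⟩ | ⟨s, hs⟩
  · refine not_exists_map_quotient H hM h₁ h₂ hne honly hCt hmax' s fun a b hab => ?_
    exact hmem _ _ (by rw [← hk', hab, hs, hk])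
  · refine not_exists_map_quotient H hM h₂ h₁ hne.symm (fun Z hZ => (honly Z hZ).symm) hCt
      hmax' s fun a b hab => ?_
    exact hmem _ _ (by rw [← hk, hab, hs, hk'])

end LengthFive

section FourNakayama

lemma nonlocalBound_of_isRightNNakayama {Λ : Type u} [Ring Λ] (hΛ : IsRightNNakayama Λ 4) :
    NonlocalBound.{u, u} Λᵐᵒᵖ := by
  intro P _ _ _ _ hP Y Z hY hZ hYZ
  obtain ⟨i, -, hi, h⟩ := hΛ.1 (ModuleCat.of Λᵐᵒᵖ P)
    (inferInstanceAs (Module.Finite Λᵐᵒᵖ P)) hP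
  have hinc : ∀ {Y Z : Submodule Λᵐᵒᵖ P}, Y ≠ ⊤ → Z ≠ ⊤ → Y ⊔ Z = ⊤ → ¬ (Y ≤ Z ∨ Z ≤ Y) := by
    rintro Y Z hY hZ hYZ (h | h)
    · exact hZ (by rwa [sup_eq_right.mpr h] at hYZ)
    · exact hY (by rwa [sup_eq_left.mpr h] at hYZ)
  rcases h with ⟨-, h⟩ | ⟨-, -, l, hl, -, h, -⟩
  · exact absurd (h Y Z) (hinc hY hZ hYZ)
  · change moduleLength Λᵐᵒᵖ P = _ at hl
    rw [moduleLength_eq] at hl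
    have hl' : len Λᵐᵒᵖ P = l := by exact_mod_cast hl
    by_contra h5
    obtain ⟨k, hk⟩ : ∃ k, l - i = k + 1 := ⟨l - i - 1, by omega⟩
    change IsUniserialModule Λᵐᵒᵖ (P ⧸ radPow Λᵐᵒᵖ P (l - i)) at h
    rw [hk, isUniserial_quotient_iff] at h
    obtain ⟨Y', hYY, hY'⟩ := exists_coatom_ge hY
    obtain ⟨Z', hZZ, hZ'⟩ := exists_coatom_ge hZ
    exact hinc hY'.1 hZ'.1 (top_le_iff.mp (hYZ ▸ sup_le_sup hYY hZZ))
      (h Y' Z' (radPow_succ_le k hY') (radPow_succ_le k hZ'))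

variable {A : Type v} [Ring A]
variable {M : Type w} [AddCommGroup M] [Module A M] [IsArtinian A M] [IsNoetherian A M]

lemma five_le_len_of_isLocal (hfs : IsNFactorSerial A M 4) (hloc : IsLocalModule A M) :
    5 ≤ len A M := by
  obtain ⟨-, -, l, hl, h4, -, hns⟩ := hfs
  rw [moduleLength_eq] at hl
  have hl' : len A M = l := by exact_mod_cast hl
  by_contra h5
  obtain rfl : l = 4 := by omega
  obtain ⟨C, hC, huniq⟩ := hloc
  have hmax : ∀ Z : Submodule A M, Z ≠ ⊤ → Z ≤ C := fun Z hZ => by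
    obtain ⟨D, hZD, hD⟩ := exists_coatom_ge hZ
    exact hZD.trans (huniq D hD).le
  have hrad : radPow A M 1 = C := radOf_eq (lt_top_iff_ne_top.mpr hC.1) fun Z hZ => hmax Z hZ.ne
  apply hns
  rw [Nat.sub_self, zero_add, hrad, isUniserial_quotient_iff]
  intro Y Z hY hZ
  by_cases h : Y = ⊤
  · exact Or.inr (h ▸ le_top)
  · exact Or.inl ((hmax Y h).trans hZ)

lemma IsUniformModule.isIndec_of_ne_bot (hM : IsUniformModule A M) {Z : Submodule A M}
    (hZ : Z ≠ ⊥) : IsIndecModule A Z :=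
  have := Submodule.nontrivial_iff_ne_bot.mpr hZ
  (hM.submodule Z).isIndec

end FourNakayama

theorem submodules_of_local_colocal_four_factor_serial
    (R : Type*) [CommRing R] [IsArtinianRing R]
    (Λ : Type u) [Ring Λ] [Algebra R Λ] [Module.Finite R Λ]
    (hΛ : IsRightNNakayama Λ 4)
    (M : Type u) [AddCommGroup M] [Module Λᵐᵒᵖ M] [Module.Finite Λᵐᵒᵖ M]
    (hind : IsIndecModule Λᵐᵒᵖ M) (hfs : IsNFactorSerial Λᵐᵒᵖ M 4)
    (hloc : IsLocalModule Λᵐᵒᵖ M) (hcoloc : IsColocalModule Λᵐᵒᵖ M) :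
    moduleLength Λᵐᵒᵖ M = (5 : ℕ) ∧
    IsAtom (moduleSoc Λᵐᵒᵖ M) ∧
    (IsIndecModule Λᵐᵒᵖ ↑(radPow Λᵐᵒᵖ M 1) ∧ ¬ IsLocalModule Λᵐᵒᵖ ↑(radPow Λᵐᵒᵖ M 1) ∧
      IsNFactorSerial Λᵐᵒᵖ ↑(radPow Λᵐᵒᵖ M 1) 4 ∧
      moduleLength Λᵐᵒᵖ ↑(radPow Λᵐᵒᵖ M 1) = (4 : ℕ)) ∧
    ∃ M1 M2 N1 N2 : Submodule Λᵐᵒᵖ M,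
      (moduleLength Λᵐᵒᵖ ↑M1 = (3 : ℕ) ∧ IsUniserialModule Λᵐᵒᵖ ↑M1) ∧
      (moduleLength Λᵐᵒᵖ ↑M2 = (3 : ℕ) ∧ ¬ IsLocalModule Λᵐᵒᵖ ↑M2 ∧
        IsNFactorSerial Λᵐᵒᵖ ↑M2 3) ∧
      (IsUniserialModule Λᵐᵒᵖ ↑N1 ∧ moduleLength Λᵐᵒᵖ ↑N1 = (2 : ℕ) ∧
        N1 ≤ M1 ∧ N1 ≤ M2) ∧
      (IsUniserialModule Λᵐᵒᵖ ↑N2 ∧ moduleLength Λᵐᵒᵖ ↑N2 = (2 : ℕ) ∧ N2 ≤ M2) ∧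
      M1 ≠ M2 ∧ N1 ≠ N2 ∧
      (∀ N : Submodule Λᵐᵒᵖ M, (N ≠ ⊥ ∧ N ≠ ⊤) ↔
        N ∈ ({radPow Λᵐᵒᵖ M 1, M1, M2, N1, N2, moduleSoc Λᵐᵒᵖ M} :
          Set (Submodule Λᵐᵒᵖ M))) := by
  have : Module.Finite R Λᵐᵒᵖ := Module.Finite.equiv (MulOpposite.opLinearEquiv R)
  have : IsArtinianRing Λᵐᵒᵖ := IsArtinianRing.of_finite R Λᵐᵒᵖ
  have H := nonlocalBound_of_isRightNNakayama hΛ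
  have hM := hcoloc.isUniform
  have h5 := five_le_len_of_isLocal hfs hloc
  obtain ⟨C₁, C₂, hC₁, hC₂, hC⟩ := exists_ne_of_isNFactorSerial H hM h5 hfs
  obtain ⟨M₁, M₂, N₁, N₂, hM₁, hM₂, hN₁, hN₂, hMne, hNne, h11, h12, h22, h21, h3, h2⟩ :=
    exists_of_five_le (R := R) H hM h5 hC₁ hC₂ hC
  have hl : len Λᵐᵒᵖ M = 5 := le_antisymm (hM.len_le_five H hM₁ hM₂ hMne h3) h5
  obtain ⟨hrad, hmax⟩ := hM.radOf_of_five_le H (N := ⊤) (by rw [len_top]; exact h5)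
  change len Λᵐᵒᵖ (radPow Λᵐᵒᵖ M 1) + 1 = _ at hrad
  change ∀ Z < ⊤, Z ≤ radPow Λᵐᵒᵖ M 1 at hmax
  rw [len_top, hl] at hrad
  have hrad4 : len Λᵐᵒᵖ (radPow Λᵐᵒᵖ M 1) = 4 := by omega
  generalize radPow Λᵐᵒᵖ M 1 = J at *
  have hle : ∀ {Z : Submodule Λᵐᵒᵖ M}, len Λᵐᵒᵖ Z < 5 → Z ≤ J := fun {Z} hZ =>
    hmax Z (lt_top_iff_ne_top.mpr fun h => by rw [h, len_top] at hZ; omega)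
  have hsoc : len Λᵐᵒᵖ (moduleSoc Λᵐᵒᵖ M) = 1 := by
    obtain ⟨S, -, hS⟩ := exists_len_le (⊤ : Submodule Λᵐᵒᵖ M) (n := 1) (by rw [len_top]; omega)
    have h := len_le (moduleSoc_le hcoloc (Z := S) (ne_bot_of_len (by omega)))
    have := len_pos hcoloc.1
    omega
  obtain ⟨hJ, hJ'⟩ := isNFactorSerial_of_two_maximal (W := J) (n := 4) (hle (by omega))
    (hle (by omega)) (by omega) (by omega) hMne hrad4 (by norm_num)
  obtain ⟨hM₂l, hM₂f⟩ := isNFactorSerial_of_two_maximal h12 h22 (by omega) (by omega) hNne hM₂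
    (by norm_num)
  have hM₁u : IsUniserialModule Λᵐᵒᵖ M₁ := by
    have key : ∀ B ≤ M₁, len Λᵐᵒᵖ B = 2 → B = N₁ := fun B hB hB2 =>
      (h2 B hB2).resolve_right fun h => h21 (h ▸ hB)
    exact hM.isUniserial hM₁.le fun B hB B' hB' e e' => (key B hB e).trans (key B' hB' e').symm
  have hu : ∀ N : Submodule Λᵐᵒᵖ M, len Λᵐᵒᵖ N = 2 → IsUniserialModule Λᵐᵒᵖ N := fun N hN =>
    hM.isUniserial (by omega) fun B hB B' hB' e e' =>
      (eq_of_len_le hB (by omega)).trans (eq_of_len_le hB' (by omega)).symm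
  have hml : ∀ {N : Submodule Λᵐᵒᵖ M} {n : ℕ}, len Λᵐᵒᵖ N = n →
      moduleLength Λᵐᵒᵖ N = (n : ℕ) := fun h => by rw [moduleLength_eq, h]
  refine ⟨by rw [moduleLength_eq, hl], hcoloc,
    ⟨hM.isIndec_of_ne_bot (ne_bot_of_len (by omega)), hJ, hJ', hml hrad4⟩,
    M₁, M₂, N₁, N₂, ⟨hml hM₁, hM₁u⟩, ⟨hml hM₂, hM₂l, hM₂f⟩, ⟨hu _ hN₁, hml hN₁, h11, h12⟩,
    ⟨hu _ hN₂, hml hN₂, h22⟩, hMne, hNne, fun N => ?_⟩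
  simp only [Set.mem_insert_iff, Set.mem_singleton_iff]
  constructor
  · rintro ⟨hb, ht⟩
    have p := len_pos hb
    have hNJ := hmax N (lt_top_iff_ne_top.mpr ht)
    have q := len_le hNJ
    obtain h | h | h | h : len Λᵐᵒᵖ N = 4 ∨ len Λᵐᵒᵖ N = 3 ∨ len Λᵐᵒᵖ N = 2 ∨
      len Λᵐᵒᵖ N = 1 := by omega
    · exact Or.inl (eq_of_len_le hNJ (by omega))
    · have := h3 N h
      tauto
    · have := h2 N h
      tauto
    · have := eq_of_len_le (moduleSoc_le hcoloc hb) (by omega)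
      tauto
  · intro h
    have hN : 0 < len Λᵐᵒᵖ N ∧ len Λᵐᵒᵖ N < 5 := by
      rcases h with rfl | rfl | rfl | rfl | rfl | rfl <;> omega
    exact ⟨ne_bot_of_len hN.1, fun h => by rw [h, len_top] at hN; omega⟩
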